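/- arXiv:1005.5359 — 3 statements merged into one kernel-verified Lean document; each statement's English description precedes it below -/
import Mathlib

section
/- Let R be a Gorenstein normal local domain of dimension d, M a maximal Cohen-Macaulay R-module such that A = Hom_R(M, M) is also maximal Cohen-Macaulay. If A has finite global dimension, then its global dimension equals exactly d. -/
universe u

open CategoryTheory Opposite IsLocalRing

def pdLE (A : Type u) [Ring A] : ℕ → ModuleCat.{u} A → Prop
  | 0, N => Module.Projective A N
  | n + 1, N => ∃ (ι : Type u) (f : (ι →₀ A) →ₗ[A] N), Function.Surjective f ∧
      pdLE A n (ModuleCat.of A (LinearMap.ker f))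

noncomputable def globalDimension (A : Type u) [Ring A] : ℕ∞ :=
  sInf {c : ℕ∞ | ∃ n : ℕ, c = (n : ℕ∞) ∧ ∀ N : ModuleCat.{u} A, pdLE A n N}

noncomputable abbrev ExtGroup (R : Type) [CommRing R] (i : ℕ)
    (M N : Type) [AddCommGroup M] [Module R M] [AddCommGroup N] [Module R N] : Type :=
  ((Ext R (ModuleCat R) i).obj (op (ModuleCat.of R M))).obj (ModuleCat.of R N)

noncomputable def moduleDepth (R : Type) [CommRing R] [IsLocalRing R]
    (M : Type) [AddCommGroup M] [Module R M] : ℕ∞ :=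
  sInf {i : ℕ∞ | ∃ n : ℕ, i = n ∧ Nontrivial (ExtGroup R n (ResidueField R) M)}

def IsMCM (R : Type) [CommRing R] [IsLocalRing R]
    (M : Type) [AddCommGroup M] [Module R M] : Prop :=
  Module.Finite R M ∧ ((moduleDepth R M : ℕ∞) : WithBot ℕ∞) = ringKrullDim R

def IsCanonicalModule (R : Type) [CommRing R] [IsLocalRing R]
    (ω : Type) [AddCommGroup ω] [Module R ω] : Prop :=
  Module.Finite R ω ∧
    (∀ i : ℕ, ((i : ℕ∞) : WithBot ℕ∞) ≠ ringKrullDim R →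
      Subsingleton (ExtGroup R i (ResidueField R) ω)) ∧
    (∀ i : ℕ, ((i : ℕ∞) : WithBot ℕ∞) = ringKrullDim R →
      Nonempty (ExtGroup R i (ResidueField R) ω ≃ₗ[R] ResidueField R))

def IsGorensteinLocalRing (R : Type) [CommRing R] [IsLocalRing R] : Prop :=
  IsNoetherianRing R ∧ IsCanonicalModule R R

namespace GDim

/-- Vanishing of `Ext`. -/
def EV (R : Type) [CommRing R] (i : ℕ) (L N : Type) [AddCommGroup L] [Module R L]
    [AddCommGroup N] [Module R N] : Prop :=
  Subsingleton (Abelian.Ext (ModuleCat.of R L) (ModuleCat.of R N) i)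

section basic

variable {R : Type} [CommRing R] {X Y Z L N : Type}
  [AddCommGroup X] [Module R X] [AddCommGroup Y] [Module R Y] [AddCommGroup Z] [Module R Z]
  [AddCommGroup L] [Module R L] [AddCommGroup N] [Module R N]

theorem bridge (i : ℕ) (h : Subsingleton (ExtGroup R i L N)) : EV R i L N := by
  let P := (projectiveResolution (ModuleCat.of R L))
  have e := (P.isoExt (R := R) i (ModuleCat.of R N)).toLinearEquiv
  have hs : Subsingleton ((P.complex.linearYonedaObj R (ModuleCat.of R N)).homology i) :=
    e.symm.toEquiv.subsingleton
  have hz := ModuleCat.isZero_of_subsingleton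
    ((P.complex.linearYonedaObj R (ModuleCat.of R N)).homology i)
  rw [← HomologicalComplex.exactAt_iff_isZero_homology] at hz
  constructor
  suffices ∀ a : Abelian.Ext (ModuleCat.of R L) (ModuleCat.of R N) i, a = 0 from
    fun a b => by rw [this a, this b]
  intro a
  obtain ⟨f, hf, rfl⟩ := P.extMk_surjective a (i+1) rfl
  cases i with
  | zero =>
    rw [HomologicalComplex.exactAt_iff' _ 0 0 1 (by simp) (by simp)] at hz
    rw [ShortComplex.moduleCat_exact_iff] at hz
    obtain ⟨g, hg⟩ := hz f hf
    have : f = 0 := by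
      rw [← hg]
      have : (P.complex.linearYonedaObj R (ModuleCat.of R N)).d 0 0 = 0 :=
        HomologicalComplex.shape _ _ _ (by simp)
      simp
      rfl
    subst this
    exact P.extMk_zero _ _
  | succ i =>
    rw [HomologicalComplex.exactAt_iff' _ i (i+1) (i+2) (by simp) (by simp)] at hz
    rw [ShortComplex.moduleCat_exact_iff] at hz
    obtain ⟨g, hg⟩ := hz f hf
    exact (P.extMk_eq_zero_iff f (i+2) rfl hf i rfl).2 ⟨g, hg⟩

theorem bridge_triv (i : ℕ) [Subsingleton N] : Subsingleton (ExtGroup R i L N) := by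
  let P := (projectiveResolution (ModuleCat.of R L))
  have e := (P.isoExt (R := R) i (ModuleCat.of R N)).toLinearEquiv
  suffices hs : Subsingleton ((P.complex.linearYonedaObj R (ModuleCat.of R N)).homology i) from
    e.toEquiv.subsingleton
  apply ModuleCat.subsingleton_of_isZero
  rw [← HomologicalComplex.exactAt_iff_isZero_homology, HomologicalComplex.exactAt_iff]
  refine ShortComplex.exact_of_isZero_X₂ _ ?_
  have : Subsingleton ((P.complex.linearYonedaObj R (ModuleCat.of R N)).X i) := by
    change Subsingleton (P.complex.X i ⟶ ModuleCat.of R N)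
    exact ModuleCat.homAddEquiv.toEquiv.subsingleton
  exact @ModuleCat.isZero_of_subsingleton _ _ _ this

variable {f : X →ₗ[R] Y} {g : Y →ₗ[R] Z}

/-- the short complex -/
noncomputable abbrev sc (hfg : Function.Exact f g) : ShortComplex (ModuleCat.{0} R) :=
  ModuleCat.shortComplexOfCompEqZero f g hfg.linearMap_comp_eq_zero

theorem sc_exact (hf : Function.Injective f) (hfg : Function.Exact f g)
    (hg : Function.Surjective g) : (sc hfg).ShortExact :=
  ModuleCat.shortComplex_shortExact (sc hfg) hfg hf hg

theorem EV.mk' {i : ℕ} (h : ∀ a : Abelian.Ext (ModuleCat.of R L) (ModuleCat.of R N) i, a = 0) :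
    EV R i L N := ⟨fun a b => by rw [h a, h b]⟩

theorem EV.eq_zero {i : ℕ} (h : EV R i L N)
    (a : Abelian.Ext (ModuleCat.of R L) (ModuleCat.of R N) i) : a = 0 := h.elim _ _

theorem contra1 (hf : Function.Injective f) (hfg : Function.Exact f g) (hg : Function.Surjective g)
    {i : ℕ} (h2 : EV R i Y N) (h3 : EV R (i+1) Z N) : EV R i X N :=
  EV.mk' fun a => by
    obtain ⟨x, rfl⟩ := Abelian.Ext.contravariant_sequence_exact₁ (sc_exact hf hfg hg) _ a
      (add_comm 1 i) (h3.eq_zero _)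
    rw [h2.eq_zero x, Abelian.Ext.comp_zero]

theorem contra2 (hf : Function.Injective f) (hfg : Function.Exact f g) (hg : Function.Surjective g)
    {i : ℕ} (h1 : EV R i X N) (h3 : EV R i Z N) : EV R i Y N :=
  EV.mk' fun a => by
    obtain ⟨x, rfl⟩ := Abelian.Ext.contravariant_sequence_exact₂ (sc_exact hf hfg hg) _ a
      (h1.eq_zero _)
    rw [h3.eq_zero x, Abelian.Ext.comp_zero]

theorem contra3 (hf : Function.Injective f) (hfg : Function.Exact f g) (hg : Function.Surjective g)
    {i : ℕ} (h1 : EV R i X N) (h2 : EV R (i+1) Y N) : EV R (i+1) Z N :=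
  EV.mk' fun a => by
    obtain ⟨x, rfl⟩ := Abelian.Ext.contravariant_sequence_exact₃ (sc_exact hf hfg hg) _ a
      (h2.eq_zero _) (add_comm 1 i)
    rw [h1.eq_zero x, Abelian.Ext.comp_zero]

theorem co1 (hf : Function.Injective f) (hfg : Function.Exact f g) (hg : Function.Surjective g)
    {i : ℕ} (h2 : EV R (i+1) L Y) (h3 : EV R i L Z) : EV R (i+1) L X :=
  EV.mk' fun a => by
    obtain ⟨x, rfl⟩ := Abelian.Ext.covariant_sequence_exact₁ _ (sc_exact hf hfg hg) a
      (h2.eq_zero _) rfl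
    rw [h3.eq_zero x, Abelian.Ext.zero_comp]

theorem co3 (hf : Function.Injective f) (hfg : Function.Exact f g) (hg : Function.Surjective g)
    {i : ℕ} (h2 : EV R i L Y) (h1 : EV R (i+1) L X) : EV R i L Z :=
  EV.mk' fun a => by
    obtain ⟨x, rfl⟩ := Abelian.Ext.covariant_sequence_exact₃ _ (sc_exact hf hfg hg) a
      rfl (h1.eq_zero _)
    rw [h2.eq_zero x, Abelian.Ext.zero_comp]

theorem ext_of_ev (hf : Function.Injective f) (hfg : Function.Exact f g) (hg : Function.Surjective g)
    (h : EV R 1 Z N) (φ : X →ₗ[R] N) : ∃ ψ : Y →ₗ[R] N, ψ ∘ₗ f = φ := by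
  obtain ⟨x, hx⟩ := Abelian.Ext.contravariant_sequence_exact₁ (sc_exact hf hfg hg) _
    (Abelian.Ext.mk₀ (ModuleCat.ofHom φ)) (add_comm 1 0) (h.eq_zero _)
  obtain ⟨x, rfl⟩ := Abelian.Ext.homEquiv₀.symm.surjective x
  refine ⟨x.hom, ?_⟩
  have := Abelian.Ext.homEquiv₀.symm.injective (a₁ := (sc hfg).f ≫ x) (a₂ := ModuleCat.ofHom φ) (by simpa using hx)
  exact congrArg ModuleCat.Hom.hom this

theorem ev_of_ext (hf : Function.Injective f) (hfg : Function.Exact f g) (hg : Function.Surjective g)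
    (h2 : EV R 1 Y N) (h : ∀ φ : X →ₗ[R] N, ∃ ψ : Y →ₗ[R] N, ψ ∘ₗ f = φ) :
    EV R 1 Z N :=
  EV.mk' fun a => by
    obtain ⟨x, rfl⟩ := Abelian.Ext.contravariant_sequence_exact₃ (sc_exact hf hfg hg) _ a
      (h2.eq_zero _) (add_comm 1 0)
    obtain ⟨x, rfl⟩ := Abelian.Ext.homEquiv₀.symm.surjective x
    obtain ⟨ψ, hψ⟩ := h x.hom
    have : x = (sc hfg).f ≫ ModuleCat.ofHom ψ := by
      ext1; exact hψ.symm
    rw [this]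
    simp only [Abelian.Ext.homEquiv₀_symm_apply]
    rw [← Abelian.Ext.mk₀_comp_mk₀, (sc_exact hf hfg hg).extClass_comp_assoc]


theorem ev_proj (i : ℕ) [Module.Projective R L] : EV R (i+1) L N :=
  EV.mk' fun a => Abelian.Ext.eq_zero_of_projective a

theorem ev_zero : EV R 0 L N ↔ Subsingleton (L →ₗ[R] N) :=
  (Abelian.Ext.addEquiv₀.trans ModuleCat.homAddEquiv).toEquiv.subsingleton_congr

theorem ev_subsingleton [Subsingleton L] (i : ℕ) : EV R i L N := by
  cases i with
  | zero => rw [ev_zero]; infer_instance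
  | succ i => exact ev_proj i

theorem ev_congr (i : ℕ) (e : X ≃ₗ[R] Y) (h : EV R i Y N) : EV R i X N :=
  contra2 (f := (e.symm : Y →ₗ[R] X)) (g := (0 : X →ₗ[R] PUnit)) e.symm.injective
    ((e.symm.exact_zero_iff_surjective _).2 e.symm.surjective)
    (Function.surjective_to_subsingleton _) h (ev_subsingleton i)

theorem ev_congr_right (i : ℕ) (e : X ≃ₗ[R] Y) (h : EV R i L Y) : EV R i L X :=
  EV.mk' fun a => by
    rw [← a.comp_mk₀_id, ← e.toModuleIso.hom_inv_id, ← Abelian.Ext.mk₀_comp_mk₀,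
      ← Abelian.Ext.comp_assoc_of_second_deg_zero, 
      h.eq_zero (a.comp (Abelian.Ext.mk₀ e.toModuleIso.hom) (add_zero i)), Abelian.Ext.zero_comp]

theorem ev_retract_right (i : ℕ) (s : X →ₗ[R] Y) (r : Y →ₗ[R] X) (hr : r ∘ₗ s = LinearMap.id) (h : EV R i L Y) : EV R i L X :=
  EV.mk' fun a => by
    have : ModuleCat.ofHom s ≫ ModuleCat.ofHom r = 𝟙 _ := by
      rw [← ModuleCat.ofHom_comp, hr]; rfl
    rw [← a.comp_mk₀_id, ← this, ← Abelian.Ext.mk₀_comp_mk₀,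
      ← Abelian.Ext.comp_assoc_of_second_deg_zero, 
      h.eq_zero (a.comp (Abelian.Ext.mk₀ (ModuleCat.ofHom s)) (add_zero i)), Abelian.Ext.zero_comp]

theorem ev_nak [IsLocalRing R] [IsNoetherianRing R] [Module.Finite R L] [Module.Finite R N]
    (i : ℕ) (x : R) (hx : x ∈ maximalIdeal R) (hreg : IsSMulRegular L x)
    (h : EV R (i+1) (QuotSMulTop x L) N) : EV R i L N := by
  have hsurj : ∀ a : Abelian.Ext (ModuleCat.of R L) (ModuleCat.of R N) i, ∃ b, x • b = a := by
    intro a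
    obtain ⟨b, hb⟩ := Abelian.Ext.contravariant_sequence_exact₁
      (IsSMulRegular.smulShortComplex_shortExact (M := ModuleCat.of R L) hreg) _ a
      (add_comm 1 i) (h.eq_zero _)
    have key : ∀ c : Abelian.Ext (ModuleCat.of R L) (ModuleCat.of R N) i,
        (Abelian.Ext.mk₀ (x • 𝟙 (ModuleCat.of R L))).comp c (zero_add i) = x • c := by
      intro c
      rw [Abelian.Ext.mk₀_smul, Abelian.Ext.smul_comp, Abelian.Ext.mk₀_id_comp]
    refine ⟨b, (key b).symm.trans ?_⟩
    rw [← hb, ModuleCat.smulShortComplex_f_eq_smul_id]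
    rfl
  have hfin : Module.Finite R (Abelian.Ext (ModuleCat.of R L) (ModuleCat.of R N) i) :=
    ModuleCat.finite_ext R (ModuleCat.of R L) (ModuleCat.of R N) i
  have : (⊤ : Submodule R (Abelian.Ext (ModuleCat.of R L) (ModuleCat.of R N) i)) = ⊥ := by
    apply Submodule.eq_bot_of_le_smul_of_le_jacobson_bot (maximalIdeal R) _ hfin.fg_top
    · rintro a -
      obtain ⟨b, rfl⟩ := hsurj a
      exact Submodule.smul_mem_smul hx trivial
    · exact (IsLocalRing.jacobson_eq_maximalIdeal _ bot_ne_top).ge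
  exact (Submodule.subsingleton_iff R).1 (subsingleton_of_top_le_bot this.le) 

end basic

end GDim

namespace GDim
open scoped Pointwise

section comm

variable {R : Type} [CommRing R] 

theorem bass_aux [IsLocalRing R] [IsNoetherianRing R] (N : Type) [AddCommGroup N] [Module R N] [Module.Finite R N]
    (d : ℕ) (h : ∀ i, d < i → EV R i (ResidueField R) N) (J : Ideal R) :
    ∀ (L : Type) [AddCommGroup L] [Module R L] [Module.Finite R L],
      J ≤ Module.annihilator R L → ∀ i, d < i → EV R i L N := by
  induction J using WellFoundedGT.induction with
  | ind J ih =>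
  intro L _ _ hLf
  induction hLf using IsNoetherianRing.induction_on_isQuotientEquivQuotientPrime R with
  | subsingleton N' => exact fun _ i _ => ev_subsingleton i
  | quotient N' p e =>
    intro hJ i hi
    apply ev_congr i e
    have hJ' : J ≤ p.1 := by
      rw [e.annihilator_eq, Ideal.annihilator_quotient] at hJ
      exact hJ
    rcases hJ'.lt_or_eq with hlt | rfl
    · exact ih _ hlt _ (by rw [Ideal.annihilator_quotient]) i hi
    · by_cases hm : p.1 = maximalIdeal R
      · rw [hm]
        exact h i hi
      · obtain ⟨x, hx, hxp⟩ := SetLike.exists_of_lt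
          ((IsLocalRing.le_maximalIdeal p.2.ne_top).lt_of_ne hm)
        apply ev_nak i x hx
        · rw [isSMulRegular_iff_right_eq_zero_of_smul]
          intro y hy
          obtain ⟨y, rfl⟩ := Ideal.Quotient.mk_surjective y
          rw [← Ideal.Quotient.mk_eq_mk, ← Submodule.Quotient.mk_smul, Ideal.Quotient.mk_eq_mk, Ideal.Quotient.eq_zero_iff_mem] at hy
          rw [Ideal.Quotient.eq_zero_iff_mem]
          exact (p.2.mem_or_mem hy).resolve_left hxp
        · refine ih (p.1 ⊔ Ideal.span {x}) ?_ _ ?_ (i+1) (by omega)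
          · refine lt_of_le_of_ne le_sup_left fun heq => hxp ?_
            rw [heq]
            exact Ideal.mem_sup_right (Ideal.mem_span_singleton_self x)
          · refine sup_le ?_ ?_
            · have := LinearMap.annihilator_le_of_surjective
                (Submodule.mkQ (x • (⊤ : Submodule R (R ⧸ p.1)))) (Submodule.mkQ_surjective _)
              rwa [Ideal.annihilator_quotient] at this
            · rw [Ideal.span_singleton_le_iff_mem, Module.mem_annihilator]
              intro y
              obtain ⟨y, rfl⟩ := Submodule.mkQ_surjective _ y
              rw [← map_smul, Submodule.mkQ_apply, Submodule.Quotient.mk_eq_zero]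
              exact Submodule.smul_mem_pointwise_smul _ _ _ trivial
  | exact N₁ N₂ N₃ f g hf hg hfg h1 h3 =>
    intro hJ i hi
    exact contra2 hf hfg hg (h1 (hJ.trans (LinearMap.annihilator_le_of_injective f hf)) i hi)
      (h3 (hJ.trans (LinearMap.annihilator_le_of_surjective g hg)) i hi)

theorem bass [IsLocalRing R] [IsNoetherianRing R] (N : Type) [AddCommGroup N] [Module R N] [Module.Finite R N]
    (d : ℕ) (h : ∀ i, d < i → EV R i (ResidueField R) N) 
    (L : Type) [AddCommGroup L] [Module R L] [Module.Finite R L] (i : ℕ) (hi : d < i) :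
    EV R i L N := bass_aux N d h ⊥ L bot_le i hi

theorem depth_shift [IsLocalRing R] [IsNoetherianRing R] (N : Type) [AddCommGroup N] [Module R N] [Module.Finite R N]
    (d : ℕ) (h : ∀ i, d < i → EV R i (ResidueField R) N) (t : ℕ) :
    ∀ (L : Type) [AddCommGroup L] [Module R L] [Module.Finite R L]
      (_ : ∀ j, j < t → EV R j (ResidueField R) L) (i : ℕ) (_ : d < i + t), EV R i L N := by
  induction t with
  | zero => intro L _ _ _ _ i hi; exact bass N d h L i hi
  | succ t ih =>
    intro L _ _ _ hL i hi
    have h0 := ev_zero.1 (hL 0 (by omega))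
    obtain ⟨x, hx, hreg⟩ := IsSMulRegular.subsingleton_linearMap_iff.mp h0
    have hx' : x ∈ maximalIdeal R := by
      have : Module.annihilator R (ResidueField R) = maximalIdeal R :=
        Ideal.annihilator_quotient
      rwa [this] at hx
    apply ev_nak i x hx' hreg
    apply ih
    · intro j hj
      exact co3 (f := LinearMap.lsmul R L x) (g := Submodule.mkQ _) hreg
        (by
          rw [LinearMap.exact_iff, Submodule.ker_mkQ]
          ext; simp [Submodule.mem_smul_pointwise_iff_exists])
        (Submodule.mkQ_surjective _) (hL j (by omega)) (hL (j+1) (by omega))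
    · omega

/-- finite free presentation -/
theorem exists_fin_pres [IsNoetherianRing R] (L : Type) [AddCommGroup L] [Module R L] [Module.Finite R L] :
    ∃ (n : ℕ) (f : (Fin n → R) →ₗ[R] L), Function.Surjective f :=
  Module.Finite.exists_fin' R L

theorem exact_ker {X Y : Type} [AddCommGroup X] [Module R X] [AddCommGroup Y] [Module R Y]
    (f : X →ₗ[R] Y) : Function.Exact (LinearMap.ker f).subtype f :=
  LinearMap.exact_subtype_ker_map f

/-- maps from a f.g. module to a direct sum have finite support -/
theorem exists_finset {L N ι : Type} [AddCommGroup L] [Module R L] [Module.Finite R L]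
    [AddCommGroup N] [Module R N] (φ : L →ₗ[R] (ι →₀ N)) :
    ∃ s : Finset ι, ∀ x, ∀ i ∉ s, φ x i = 0 := by
  classical
  obtain ⟨S, hS⟩ := Module.Finite.fg_top (R := R) (M := L)
  refine ⟨S.biUnion fun x => (φ x).support, fun x i hi => ?_⟩
  have : x ∈ Submodule.span R (S : Set L) := hS ▸ trivial
  induction this using Submodule.span_induction with
  | mem y hy =>
    by_contra hne
    exact hi (Finset.mem_biUnion.2 ⟨y, hy, Finsupp.mem_support_iff.2 hne⟩)
  | zero => simp
  | add y z _ _ hy hz => simp [hy, hz]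
  | smul a y _ hy => simp [hy]

/-- assemble a map to a direct sum from finitely many components -/
theorem exists_assemble {L N ι : Type} [AddCommGroup L] [Module R L]
    [AddCommGroup N] [Module R N] (s : Finset ι) (c : ι → L →ₗ[R] N) :
    ∃ φ : L →ₗ[R] (ι →₀ N), ∀ x i, (i ∈ s → φ x i = c i x) ∧ (i ∉ s → φ x i = 0) := by
  classical
  refine ⟨∑ i ∈ s, Finsupp.lsingle i ∘ₗ c i, fun x i => ?_⟩
  simp only [LinearMap.sum_apply, LinearMap.comp_apply, Finsupp.lsingle_apply, Finsupp.finsetSum_apply, Finsupp.single_apply]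
  simp +contextual

theorem ev_directSum [IsNoetherianRing R] {N : Type} (ι : Type)
    [AddCommGroup N] [Module R N] (i : ℕ) :
    ∀ (L : Type) [AddCommGroup L] [Module R L] [Module.Finite R L], EV R i L N → EV R i L (ι →₀ N) := by
  induction i with
  | zero =>
    intro L _ _ _ h
    rw [ev_zero] at h ⊢
    refine ⟨fun a b => ?_⟩
    ext x i
    exact congrArg (fun f => f x) (h.elim (Finsupp.lapply i ∘ₗ a) (Finsupp.lapply i ∘ₗ b))
  | succ i ih =>
    intro L _ _ _ h
    obtain ⟨n, f, hf⟩ := Module.Finite.exists_fin' R L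
    have hi := (LinearMap.ker f).subtype_injective
    cases i with
    | zero =>
      refine ev_of_ext hi (exact_ker f) hf (ev_proj 0) fun φ => ?_
      obtain ⟨s, hs⟩ := exists_finset φ
      have hex : ∀ j, ∃ ψ : (Fin n → R) →ₗ[R] N, ψ ∘ₗ (LinearMap.ker f).subtype = Finsupp.lapply j ∘ₗ φ :=
        fun j => ext_of_ev hi (exact_ker f) hf h _
      choose c hc using hex
      obtain ⟨ψ, hψ⟩ := exists_assemble s c
      refine ⟨ψ, ?_⟩
      ext x j
      by_cases hj : j ∈ s
      · exact ((hψ _ j).1 hj).trans (congrArg (fun f => f x) (hc j))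
      · exact ((hψ _ j).2 hj).trans (hs x j hj).symm
    | succ i =>
      exact contra3 hi (exact_ker f) hf (ih _ (contra1 hi (exact_ker f) hf (ev_proj i) h)) (ev_proj _)

theorem mapRange_exact {X Y Z : Type} (ι : Type) [AddCommGroup X] [Module R X]
    [AddCommGroup Y] [Module R Y] [AddCommGroup Z] [Module R Z]
    {f : X →ₗ[R] Y} {g : Y →ₗ[R] Z} (hf : Function.Injective f) (hfg : Function.Exact f g) 
    (hg : Function.Surjective g) :
    Function.Injective (Finsupp.mapRange.linearMap f : (ι →₀ X) →ₗ[R] (ι →₀ Y)) ∧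
    Function.Exact (Finsupp.mapRange.linearMap f : (ι →₀ X) →ₗ[R] (ι →₀ Y))
      (Finsupp.mapRange.linearMap g : (ι →₀ Y) →ₗ[R] (ι →₀ Z)) ∧
    Function.Surjective (Finsupp.mapRange.linearMap g : (ι →₀ Y) →ₗ[R] (ι →₀ Z)) := by
  refine ⟨fun a b h => ?_, fun y => ⟨fun h => ?_, ?_⟩, fun z => ?_⟩
  · ext i
    apply hf
    have := DFunLike.congr_fun h i
    simpa using this
  · have : ∀ i, ∃ x, f x = y i := fun i => (hfg (y i)).1 (by
      have := DFunLike.congr_fun h i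
      simpa using this)
    classical
    choose c hc using this
    refine ⟨Finsupp.onFinset y.support c fun i hi => ?_, ?_⟩
    · rw [Finsupp.mem_support_iff, ← hc]
      intro h0
      exact hi (hf (h0.trans (map_zero f).symm))
    · ext i
      simp [hc]
  · rintro ⟨x, rfl⟩
    ext i
    simp [hfg.apply_apply_eq_zero]
  · obtain ⟨y, hy⟩ := Finsupp.mapRange_surjective (α := ι) g (map_zero g) hg z
    exact ⟨y, by rw [← hy]; rfl⟩

theorem exists_proj_pres (L : Type) [AddCommGroup L] [Module R L] :
    ∃ (F : Type) (_ : AddCommGroup F) (_ : Module R F) (_ : Module.Free R F) (f : F →ₗ[R] L),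
      Function.Surjective f :=
  ⟨L →₀ R, inferInstance, inferInstance, inferInstance, _,
    Finsupp.linearCombination_id_surjective R L⟩

/-- `Ext` out of a direct sum -/
theorem ev_sum_left {N : Type} (ι : Type)
    [AddCommGroup N] [Module R N] (i : ℕ) :
    ∀ (L : Type) [AddCommGroup L] [Module R L], EV R (i+1) L N → EV R (i+1) (ι →₀ L) N := by
  induction i with
  | zero =>
    intro L _ _ h
    obtain ⟨F, _, _, _, f, hf⟩ := exists_proj_pres (R := R) L
    have hi := (LinearMap.ker f).subtype_injective
    obtain ⟨h1, h2, h3⟩ := mapRange_exact ι hi (exact_ker f) hf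
    refine ev_of_ext h1 h2 h3 (ev_proj 0) fun φ => ?_
    have hex : ∀ j, ∃ ψ : F →ₗ[R] N, ψ ∘ₗ (LinearMap.ker f).subtype = φ ∘ₗ Finsupp.lsingle j :=
      fun j => ext_of_ev hi (exact_ker f) hf h _
    choose c hc using hex
    refine ⟨Finsupp.lsum ℕ c, ?_⟩
    ext j x
    have := congrArg (fun f => f x) (hc j)
    simpa using this
  | succ i ih =>
    intro L _ _ h
    obtain ⟨F, _, _, _, f, hf⟩ := exists_proj_pres (R := R) L
    have hi := (LinearMap.ker f).subtype_injective
    obtain ⟨h1, h2, h3⟩ := mapRange_exact ι hi (exact_ker f) hf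
    exact contra3 h1 h2 h3 (ih _ (contra1 hi (exact_ker f) hf (ev_proj i) h)) (ev_proj _)

/-- Baer -/
theorem injdim (d : ℕ) : ∀ (N : Type) [AddCommGroup N] [Module R N]
    (_ : ∀ (L : Type) [AddCommGroup L] [Module R L] [Module.Finite R L], EV R (d+1) L N)
    (L : Type) [AddCommGroup L] [Module R L], EV R (d+1) L N := by
  induction d with
  | zero =>
    intro N _ _ h L _ _
    have hB : Module.Baer R N := by
      intro I φ
      obtain ⟨ψ, hψ⟩ := ext_of_ev (f := I.subtype) (g := I.mkQ) I.subtype_injective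
        (LinearMap.exact_subtype_mkQ I) I.mkQ_surjective (h (R ⧸ I)) φ
      exact ⟨ψ, fun x hx => congrArg (fun f => f ⟨x, hx⟩) hψ⟩
    have := hB.injective
    have : Injective (ModuleCat.of R N) := Module.injective_object_of_injective_module R N
    exact EV.mk' fun a => a.eq_zero_of_injective
  | succ d ih =>
    intro N _ _ h L _ _
    obtain ⟨I, _, f, _⟩ := EnoughInjectives.presentation (ModuleCat.of R N)
    have injf : Function.Injective f.hom := (ModuleCat.mono_iff_injective f).mp ‹_›
    have hI : ∀ (i : ℕ) (L : Type) [AddCommGroup L] [Module R L], EV R (i+1) L I :=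
      fun i L _ _ => EV.mk' fun a => a.eq_zero_of_injective
    have hex := f.hom.exact_map_mkQ_range
    exact co1 injf hex (Submodule.mkQ_surjective _) (hI _ L) 
      (ih _ (fun L _ _ _ => co3 injf hex (Submodule.mkQ_surjective _) (hI _ L) (h L)) L)

theorem injdim' (d : ℕ) (N : Type) [AddCommGroup N] [Module R N]
    (h : ∀ (L : Type) [AddCommGroup L] [Module R L] [Module.Finite R L], EV R (d+1) L N)
    (L : Type) [AddCommGroup L] [Module R L] (i : ℕ) (hi : d < i) : EV R i L N := by
  have key := injdim d N h
  obtain ⟨k, rfl⟩ := Nat.exists_eq_add_of_le hi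
  clear hi
  induction k generalizing L with
  | zero => exact key L
  | succ k ih =>
    exact contra3 (LinearMap.ker _).subtype_injective (exact_ker _)
      (Finsupp.linearCombination_id_surjective R L) (ih _) (ev_proj _)

end comm
end GDim

namespace GDim

section refl

variable {R : Type} [CommRing R]

theorem dual_seq {F N : Type} [AddCommGroup F] [Module R F] [AddCommGroup N] [Module R N]
    {f : F →ₗ[R] N} (hf : Function.Surjective f) (hN : EV R 1 N R) :
    Function.Injective f.dualMap ∧
    Function.Exact f.dualMap (LinearMap.ker f).subtype.dualMap ∧
    Function.Surjective (LinearMap.ker f).subtype.dualMap := by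
  refine ⟨LinearMap.dualMap_injective_of_surjective hf, fun φ => ⟨fun h => ?_, ?_⟩, fun φ => ?_⟩
  · have hk : LinearMap.ker f ≤ LinearMap.ker φ := fun x hx => by
      have := DFunLike.congr_fun h ⟨x, hx⟩
      simpa using this
    let e := f.quotKerEquivOfSurjective hf
    refine ⟨(LinearMap.ker f).liftQ φ hk ∘ₗ e.symm.toLinearMap, ?_⟩
    ext x
    have : e.symm (f x) = (LinearMap.ker f).mkQ x := by
      rw [LinearEquiv.symm_apply_eq]; rfl
    simp [this]
  · rintro ⟨ψ, rfl⟩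
    ext x
    simp
  · obtain ⟨ψ, hψ⟩ := ext_of_ev (LinearMap.ker f).subtype_injective (exact_ker f) hf hN φ
    exact ⟨ψ, hψ⟩

theorem gc_syz {F N : Type} [AddCommGroup F] [Module R F] [Module.Projective R F]
    [AddCommGroup N] [Module R N] {f : F →ₗ[R] N} (hf : Function.Surjective f)
    (hN : ∀ i, EV R (i+1) N R) (i : ℕ) : EV R (i+1) (LinearMap.ker f) R :=
  contra1 (LinearMap.ker f).subtype_injective (exact_ker f) hf (ev_proj i) (hN (i+1))

theorem ev_dual [IsNoetherianRing R]
    (d : ℕ) (hR : ∀ (L : Type) [AddCommGroup L] [Module R L] (i : ℕ), d < i → EV R i L R) (t : ℕ) : ∀ (i : ℕ) (_ : d < i + 1 + t)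
    (N : Type) [AddCommGroup N] [Module R N] [Module.Finite R N]
    (_ : ∀ i, EV R (i+1) N R), EV R (i+1) (Module.Dual R N) R := by
  induction t with
  | zero => intro i hi N _ _ _ _; exact hR _ _ hi
  | succ t ih =>
    intro i hi N _ _ _ hN
    obtain ⟨n, f, hf⟩ := Module.Finite.exists_fin' R N
    obtain ⟨h1, h2, h3⟩ := dual_seq hf (hN 0)
    exact contra1 h1 h2 h3 (ev_proj i) (ih (i+1) (by omega) _ (gc_syz hf hN))

theorem refl_surj [IsNoetherianRing R]
    (d : ℕ) (hR : ∀ (L : Type) [AddCommGroup L] [Module R L] (i : ℕ), d < i → EV R i L R)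
    (N : Type) [AddCommGroup N] [Module R N] [Module.Finite R N]
    (hN : ∀ i, EV R (i+1) N R) (Φ : Module.Dual R N →ₗ[R] R) : ∃ x : N, ∀ φ, Φ φ = φ x := by
  obtain ⟨n, f, hf⟩ := Module.Finite.exists_fin' R N
  obtain ⟨h1, h2, h3⟩ := dual_seq hf (hN 0)
  obtain ⟨Ψ, hΨ⟩ := ext_of_ev h1 h2 h3 (ev_dual d hR d 0 (by omega) _ (gc_syz hf hN)) Φ
  obtain ⟨x, rfl⟩ := (Module.bijective_dual_eval R (Fin n → R)).2 Ψ
  refine ⟨f x, fun φ => ?_⟩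
  rw [← hΨ]
  rfl

theorem refl_inj [IsNoetherianRing R]
    (d : ℕ) (hR : ∀ (L : Type) [AddCommGroup L] [Module R L] (i : ℕ), d < i → EV R i L R)
    (N : Type) [AddCommGroup N] [Module R N] [Module.Finite R N]
    (hN : ∀ i, EV R (i+1) N R) (y : N) (hy : ∀ φ : Module.Dual R N, φ y = 0) : y = 0 := by
  obtain ⟨n, f, hf⟩ := Module.Finite.exists_fin' R N
  obtain ⟨h1, h2, h3⟩ := dual_seq hf (hN 0)
  obtain ⟨x, rfl⟩ := hf y
  have hk : LinearMap.ker (LinearMap.ker f).subtype.dualMap ≤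
      LinearMap.ker (Module.Dual.eval R (Fin n → R) x) := by
    intro φ hφ
    obtain ⟨ψ, rfl⟩ := (h2 φ).1 hφ
    exact hy ψ
  let e := (LinearMap.ker f).subtype.dualMap.quotKerEquivOfSurjective h3
  obtain ⟨z, hz⟩ := refl_surj d hR _ (gc_syz hf hN)
    ((LinearMap.ker _).liftQ (Module.Dual.eval R (Fin n → R) x) hk ∘ₗ e.symm.toLinearMap)
  have : x = z.1 := by
    apply (Module.bijective_dual_eval R (Fin n → R)).1
    ext1 φ
    have h := hz ((LinearMap.ker f).subtype.dualMap φ)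
    have h' : e.symm ((LinearMap.ker f).subtype.dualMap φ) = (LinearMap.ker _).mkQ φ := by
      rw [LinearEquiv.symm_apply_eq]; rfl
    rw [LinearMap.comp_apply, LinearEquiv.coe_coe, h'] at h
    exact h
  rw [this]
  exact z.2

end refl
end GDim

namespace GDim

section trace
open TensorProduct Polynomial

/-- the trace of an integral endomorphism is integral -/
theorem isIntegral_trace_of (R K : Type) [CommRing R] [Field K] [Algebra R K]
    (V : Type) [AddCommGroup V] [Module K V] [Module.Finite K V] (f : Module.End K V)
    (p : R[X]) (hp : p.Monic) (hpf : aeval f (p.map (algebraMap R K)) = 0) :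
    IsIntegral R (LinearMap.trace K V f) := by
  let L := AlgebraicClosure K
  let g : Module.End L (L ⊗[K] V) := f.baseChange L
  have hg : aeval g (p.map (algebraMap R L)) = 0 := by
    have h1 := congrArg (Module.End.baseChangeHom K L V) hpf
    rw [map_zero, ← aeval_algHom_apply] at h1
    rw [IsScalarTower.algebraMap_eq R K L, ← Polynomial.map_map, aeval_map_algebraMap]
    exact h1
  have hInt : IsIntegral R (LinearMap.trace L (L ⊗[K] V) g) := by
    rw [Module.End.trace_eq_sum_roots_charpoly_of_splits (IsAlgClosed.splits _)]
    refine IsIntegral.multiset_sum fun μ hμ => ?_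
    have hμ' := (Module.End.hasEigenvalue_iff_isRoot_charpoly g μ).2 (isRoot_of_mem_roots hμ)
    obtain ⟨v, hv⟩ := hμ'.exists_hasEigenvector
    have := Module.End.aeval_apply_of_hasEigenvector (p := p.map (algebraMap R L)) hv
    rw [hg] at this
    have h0 := (smul_eq_zero.1 this.symm).resolve_right hv.2
    exact ⟨p, hp, by rwa [Polynomial.eval_map] at h0⟩
  have h2 : LinearMap.trace L (L ⊗[K] V) g = algebraMap K L (LinearMap.trace K V f) :=
    LinearMap.trace_baseChange f L
  rw [h2] at hInt
  exact (isIntegral_algebraMap_iff (algebraMap K L).injective).1 hInt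

theorem trace_rank_one {K V : Type} [Field K] [AddCommGroup V] [Module K V] [Module.Finite K V]
    (f : V →ₗ[K] K) (m : V) : LinearMap.trace K V (f.smulRight m) = f m := by
  have : f.smulRight m = dualTensorHom K V V (f ⊗ₜ m) := by
    ext x; simp
  rw [this, LinearMap.trace_eq_contract_apply, contractLeft_apply]

theorem exists_tr (R : Type) [CommRing R] [IsDomain R] [IsIntegrallyClosed R]
    (M : Type) [AddCommGroup M] [Module R M] [Module.Finite R M] :
    ∃ tr : Module.End R M →ₗ[R] R, (∀ a b, tr (a * b) = tr (b * a)) ∧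
      ∀ (f : M →ₗ[R] R) (m : M), tr (f.smulRight m) = f m := by
  let K := FractionRing R
  let T : Module.End R M →ₗ[R] K := (LinearMap.trace K (K ⊗[R] M)).restrictScalars R ∘ₗ
    (LinearMap.baseChangeHom R K M M)
  have hT : ∀ b, ∃ r, algebraMap R K r = T b := by
    intro b
    apply IsIntegrallyClosed.algebraMap_eq_of_integral
    obtain ⟨p, hp, hpb⟩ := Algebra.IsIntegral.isIntegral (R := R) b
    apply isIntegral_trace_of R K _ _ p hp
    rw [aeval_map_algebraMap]
    have h1 := congrArg (Module.End.baseChangeHom R K M) hpb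
    rw [map_zero, ← aeval_def, ← aeval_algHom_apply] at h1
    exact h1
  have inj := IsFractionRing.injective R K
  choose tr htr using hT
  refine ⟨⟨⟨tr, fun a b => inj (by rw [map_add, htr, htr, htr, map_add])⟩,
    fun r b => inj (by
      rw [RingHom.id_apply, smul_eq_mul, map_mul, htr, htr, map_smul, Algebra.smul_def])⟩,
    fun a b => inj ?_, fun f m => inj ?_⟩
  · change algebraMap R K (tr _) = algebraMap R K (tr _)
    rw [htr, htr]
    change LinearMap.trace K _ ((a * b).baseChange K) = LinearMap.trace K _ ((b * a).baseChange K)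
    rw [LinearMap.baseChange_mul, LinearMap.baseChange_mul, LinearMap.trace_mul_comm]
  · change algebraMap R K (tr _) = algebraMap R K (f m)
    rw [htr]
    change LinearMap.trace K _ ((f.smulRight m).baseChange K) = _
    let F : (K ⊗[R] M) →ₗ[K] K := (AlgebraTensorModule.rid R K K).toLinearMap ∘ₗ f.baseChange K
    have : (f.smulRight m).baseChange K = F.smulRight (1 ⊗ₜ m) := by
      ext x
      simp [F, TensorProduct.smul_tmul', -TensorProduct.tmul_smul, TensorProduct.smul_tmul]
    rw [this, trace_rank_one]
    simp [F, Algebra.algebraMap_eq_smul_one]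

/-- some nonzero multiple of the identity is a sum of rank one maps -/
theorem exists_rank_one (R : Type) [CommRing R] [IsDomain R] [IsNoetherianRing R]
    (M : Type) [AddCommGroup M] [Module R M] [Module.Finite R M]
    (hM : ∀ y : M, (∀ φ : Module.Dual R M, φ y = 0) → y = 0) :
    ∃ r : R, r ≠ 0 ∧ r • (1 : Module.End R M) ∈ Submodule.span R
      {h : Module.End R M | ∃ (f : M →ₗ[R] R) (m : M), h = f.smulRight m} := by
  let K := FractionRing R
  let V := K ⊗[R] M
  let mk : M →ₗ[R] V := TensorProduct.mk R K M 1
  have : Module.FinitePresentation R M := Module.finitePresentation_of_finite R M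
  have hloc : IsLocalizedModule (nonZeroDivisors R) mk := by infer_instance
  have inj : Function.Injective mk := by
    rw [injective_iff_map_eq_zero]
    intro y hy
    obtain ⟨s, hs⟩ := (IsLocalizedModule.eq_zero_iff (nonZeroDivisors R) mk).1 hy
    refine hM y fun φ => ?_
    have h2 := congrArg φ hs
    rw [map_zero, Submonoid.smul_def, map_smul, smul_eq_mul] at h2
    exact (mul_eq_zero.1 h2).resolve_left (nonZeroDivisors.ne_zero s.2)
  set S := Submodule.span R
      {h : Module.End R M | ∃ (f : M →ₗ[R] R) (m : M), h = f.smulRight m} with hS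
  let P : (M →ₗ[R] V) → Prop := fun g => ∃ r : R, r ≠ 0 ∧ ∃ h ∈ S, ∀ x, mk (h x) = r • g x
  have hsum : ∀ (ι : Type) (s : Finset ι) (g : ι → (M →ₗ[R] V)), (∀ i ∈ s, P (g i)) →
      P (∑ i ∈ s, g i) := by
    intro ι s g hg
    refine Finset.sum_induction g P ?_ ?_ hg
    · rintro a b ⟨r, hr, h, hh, e⟩ ⟨r', hr', h', hh', e'⟩
      refine ⟨r * r', mul_ne_zero hr hr', r' • h + r • h',
        S.add_mem (S.smul_mem _ hh) (S.smul_mem _ hh'), fun x => ?_⟩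
      simp only [LinearMap.add_apply, LinearMap.smul_apply, map_add, map_smul, e, e', smul_add,
        smul_smul, mul_comm r' r]
    · exact ⟨1, one_ne_zero, 0, S.zero_mem, fun x => by simp⟩
  have hmk : P mk := by
    let b := Module.finBasis K V
    have : mk = ∑ i, (((b.coord i).restrictScalars R) ∘ₗ mk).smulRight (b i) := by
      ext x
      rw [LinearMap.sum_apply]
      exact (b.sum_repr (mk x)).symm
    rw [this]
    refine hsum _ _ _ fun i _ => ?_
    obtain ⟨f, s, hf⟩ := Module.FinitePresentation.exists_lift_of_isLocalizedModule
      (nonZeroDivisors R) (Algebra.linearMap R K) (((b.coord i).restrictScalars R) ∘ₗ mk)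
    obtain ⟨⟨m, t⟩, hm⟩ := IsLocalizedModule.surj (nonZeroDivisors R) mk (b i)
    refine ⟨t * s, mul_ne_zero (nonZeroDivisors.ne_zero t.2) (nonZeroDivisors.ne_zero s.2),
      f.smulRight m, Submodule.subset_span ⟨f, m, rfl⟩, fun x => ?_⟩
    have h1 : algebraMap R K (f x) = s • (b.coord i (mk x)) := DFunLike.congr_fun hf x
    have h2 : t • b i = mk m := hm
    rw [Submonoid.smul_def] at h1 h2
    rw [LinearMap.smulRight_apply, map_smul, ← h2, LinearMap.smulRight_apply,
      ← algebraMap_smul K (f x), h1, smul_comm, mul_smul, smul_assoc]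
    rfl
  obtain ⟨r, hr, h, hh, e⟩ := hmk
  refine ⟨r, hr, ?_⟩
  have : r • (1 : Module.End R M) = h := by
    ext x
    apply inj
    rw [e]
    simp
  rwa [this]

end trace
end GDim

namespace GDim

section perfect

theorem perfect_nondeg {R M : Type} [CommRing R] [AddCommGroup M] [Module R M]
    (hinj : ∀ y : M, (∀ φ : Module.Dual R M, φ y = 0) → y = 0)
    (tr : Module.End R M →ₗ[R] R)
    (htr : ∀ (f : M →ₗ[R] R) (m : M), tr (f.smulRight m) = f m)
    (a : Module.End R M) (ha : ∀ x, tr (x * a) = 0) : a = 0 := by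
  ext m
  refine hinj _ fun f => ?_
  have h1 : f.smulRight m * a = (f ∘ₗ a).smulRight m := by ext x; simp
  have h2 := ha (f.smulRight m)
  rw [h1, htr] at h2
  exact h2

theorem perfect_surj {R M : Type} [CommRing R] [IsDomain R] [IsNoetherianRing R]
    [AddCommGroup M] [Module R M] [Module.Finite R M]
    (hinj : ∀ y : M, (∀ φ : Module.Dual R M, φ y = 0) → y = 0)
    (hsurj : ∀ Φ : Module.Dual R M →ₗ[R] R, ∃ x : M, ∀ φ, Φ φ = φ x)
    (tr : Module.End R M →ₗ[R] R)
    (htr : ∀ (f : M →ₗ[R] R) (m : M), tr (f.smulRight m) = f m)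
    (φ : Module.End R M →ₗ[R] R) : ∃ a : Module.End R M, ∀ x, φ x = tr (x * a) := by
  have hex : ∀ m : M, ∃ y : M, ∀ f : M →ₗ[R] R, φ (f.smulRight m) = f y := by
    intro m
    let Φ : Module.Dual R M →ₗ[R] R :=
      { toFun := fun f => φ (LinearMap.smulRight f m)
        map_add' := fun f g => by
          rw [← map_add]; congr 1; ext x; simp [add_smul]
        map_smul' := fun r f => by
          rw [RingHom.id_apply, ← map_smul]; congr 1; ext x; simp [mul_smul] }
    exact hsurj Φ
  choose a ha using hex
  have ext' : ∀ y z : M, (∀ f : Module.Dual R M, f y = f z) → y = z := fun y z h =>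
    sub_eq_zero.1 (hinj _ fun f => by rw [map_sub, h, sub_self])
  let α : Module.End R M :=
    { toFun := a
      map_add' := fun x y => ext' _ _ fun f => by
        rw [map_add, ← ha, ← ha, ← ha, ← map_add]; congr 1; ext z; simp
      map_smul' := fun r x => ext' _ _ fun f => by
        rw [RingHom.id_apply, map_smul, ← ha, ← ha, ← map_smul]; congr 1; ext z
        exact smul_comm _ _ _ }
  refine ⟨α, fun b => ?_⟩
  obtain ⟨r, hr, hmem⟩ := exists_rank_one R M hinj
  have key : ∀ h ∈ Submodule.span R
      {h : Module.End R M | ∃ (f : M →ₗ[R] R) (m : M), h = f.smulRight m},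
      φ (b * h) = tr (b * h * α) := by
    intro h hh
    induction hh using Submodule.span_induction with
    | mem h hh =>
      obtain ⟨f, m, rfl⟩ := hh
      have h1 : b * f.smulRight m = f.smulRight (b m) := by ext x; simp
      have h2 : f.smulRight (b m) * α = (f ∘ₗ α).smulRight (b m) := by ext x; simp
      rw [h1, h2, htr, ha]
      rfl
    | zero => simp
    | add x y _ _ hx hy => rw [mul_add, add_mul, map_add, map_add, hx, hy]
    | smul r x _ hx => rw [mul_smul_comm, smul_mul_assoc, map_smul, map_smul, hx]
  have := key _ hmem
  rw [mul_smul_comm, smul_mul_assoc, map_smul, map_smul, mul_one] at this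
  exact mul_left_cancel₀ hr this

end perfect

section alg

variable {R A : Type} [CommRing R] [Ring A] [Algebra R A]

theorem lift_tr [Module.Finite R A] (tr : A →ₗ[R] R) (hnd : ∀ a, (∀ x, tr (x * a) = 0) → a = 0)
    (hsurj : ∀ φ : A →ₗ[R] R, ∃ a, ∀ x, φ x = tr (x * a))
    {B I : Type} [AddCommGroup B] [Module A B] [Module R B] [IsScalarTower R A B]
    (h : B →ₗ[R] (I →₀ R)) : ∃ g : B →ₗ[A] (I →₀ A), ∀ b i, tr (g b i) = h b i := by
  classical
  have inj : ∀ a a', (∀ x, tr (x * a) = tr (x * a')) → a = a' := fun a a' h =>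
    sub_eq_zero.1 (hnd _ fun x => by rw [mul_sub, map_sub, h, sub_self])
  have h1 : ∀ b : B, ∃ s : Finset I, ∀ x : A, ∀ i ∉ s, h (x • b) i = 0 := fun b =>
    exists_finset (h ∘ₗ (LinearMap.toSpanSingleton A B b).restrictScalars R)
  have h2 : ∀ (b : B) (i : I), ∃ a, ∀ x : A, h (x • b) i = tr (x * a) := fun b i =>
    hsurj (Finsupp.lapply i ∘ₗ h ∘ₗ (LinearMap.toSpanSingleton A B b).restrictScalars R)
  choose s hs using h1
  choose c hc using h2
  have hc0 : ∀ b i, c b i ≠ 0 → i ∈ s b := by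
    intro b i hne
    by_contra hi
    exact hne (hnd _ fun x => by rw [← hc, hs b x i hi])
  let g : B →ₗ[A] (I →₀ A) :=
    { toFun := fun b => Finsupp.onFinset (s b) (c b) (hc0 b)
      map_add' := fun b b' => by
        ext i
        apply inj
        intro x
        simp only [Finsupp.onFinset_apply, Finsupp.add_apply, mul_add, map_add, ← hc, smul_add]
      map_smul' := fun y b => by
        ext i
        apply inj
        intro x
        simp only [Finsupp.onFinset_apply, Finsupp.smul_apply, smul_eq_mul, RingHom.id_apply,
          ← mul_assoc, ← hc, mul_smul] }
  refine ⟨g, fun b i => ?_⟩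
  have := hc b i 1
  rw [one_smul, one_mul] at this
  exact this.symm

theorem proj_of_ev [Module.Finite R A] (tr : A →ₗ[R] R)
    (hnd : ∀ a, (∀ x, tr (x * a) = 0) → a = 0)
    (hsurj : ∀ φ : A →ₗ[R] R, ∃ a, ∀ x, φ x = tr (x * a))
    {F B : Type} [AddCommGroup F] [Module A F] [Module R F] [IsScalarTower R A F]
    [AddCommGroup B] [Module A B] [Module R B] [IsScalarTower R A B]
    (f : F →ₗ[A] B) (hf : Function.Surjective f) [Module.Projective A F]
    (hK : Module.Projective A (LinearMap.ker f)) (hB : ∀ I : Type, EV R 1 B (I →₀ R)) :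
    Module.Projective A B := by
  obtain ⟨s, hs⟩ := hK.out
  let K := LinearMap.ker f
  let i : K →ₗ[A] F := K.subtype
  let φ : K →ₗ[R] (K →₀ R) := Finsupp.mapRange.linearMap tr ∘ₗ s.restrictScalars R
  obtain ⟨ψ, hψ⟩ := ext_of_ev (f := i.restrictScalars R) (g := f.restrictScalars R)
    K.subtype_injective (LinearMap.exact_subtype_ker_map f) hf (hB K) φ
  obtain ⟨g, hg⟩ := lift_tr tr hnd hsurj ψ
  have hgi : ∀ x : K, g x = s x := by
    intro x
    ext j
    refine sub_eq_zero.1 (hnd _ fun a => ?_)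
    have h1 : tr (g (i (a • x)) j) = tr (s (a • x) j) := by
      rw [hg]
      have := DFunLike.congr_fun (DFunLike.congr_fun hψ (a • x)) j
      simpa [φ] using this
    rw [map_smul, map_smul, map_smul, Finsupp.smul_apply, Finsupp.smul_apply] at h1
    rw [mul_sub, map_sub, sub_eq_zero]
    exact h1
  let ρ : F →ₗ[A] K := Finsupp.linearCombination A id ∘ₗ g
  have hρ : ∀ x : K, ρ x = x := fun x => by
    change Finsupp.linearCombination A id (g x) = x
    rw [hgi]; exact hs x
  let e := f.quotKerEquivOfSurjective hf
  have hle : LinearMap.ker f ≤ LinearMap.ker (LinearMap.id - i ∘ₗ ρ) := by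
    intro x hx
    have := hρ ⟨x, hx⟩
    rw [LinearMap.mem_ker, LinearMap.sub_apply, sub_eq_zero]
    exact (congrArg i this).symm
  let σ : B →ₗ[A] F := (LinearMap.ker f).liftQ _ hle ∘ₗ e.symm.toLinearMap
  refine Module.Projective.of_split σ f ?_
  ext b
  obtain ⟨y, rfl⟩ := hf b
  have h' : e.symm (f y) = (LinearMap.ker f).mkQ y := by
    rw [LinearEquiv.symm_apply_eq]; rfl
  have h2 : σ (f y) = y - i (ρ y) := by
    rw [LinearMap.comp_apply, LinearEquiv.coe_coe, h']
    rfl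
  rw [LinearMap.comp_apply, h2, map_sub, LinearMap.id_apply]
  have : f (i (ρ y)) = 0 := (ρ y).2
  rw [this, sub_zero]

theorem descend [Module.Finite R A] (tr : A →ₗ[R] R)
    (hnd : ∀ a, (∀ x, tr (x * a) = 0) → a = 0)
    (hsurj : ∀ φ : A →ₗ[R] R, ∃ a, ∀ x, φ x = tr (x * a))
    (hAR : ∀ (i : ℕ) (ι I : Type), EV R (i+1) (ι →₀ A) (I →₀ R)) (n : ℕ) :
    ∀ (B : Type) [AddCommGroup B] [Module A B] [Module R B] [IsScalarTower R A B]
      (_ : ∀ I : Type, EV R (n+1) B (I →₀ R)),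
      pdLE A (n+1) (ModuleCat.of A B) → pdLE A n (ModuleCat.of A B) := by
  induction n with
  | zero =>
    rintro B _ _ _ _ hB ⟨ι, f, hf, hK⟩
    exact proj_of_ev (F := ι →₀ A) (B := B) tr hnd hsurj f hf hK hB
  | succ n ih =>
    rintro B _ _ _ _ hB ⟨ι, f, hf, hK⟩
    refine ⟨ι, f, hf, ?_⟩
    let f' : (ι →₀ A) →ₗ[A] B := f
    refine ih (LinearMap.ker f') (fun I => ?_) hK
    exact contra1 (f := (LinearMap.ker f').subtype.restrictScalars R)
      (g := f'.restrictScalars R) (LinearMap.ker f').subtype_injective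
      (LinearMap.exact_subtype_ker_map f') hf (hAR n ι I) (hB I)

theorem lower (k : Type) [AddCommGroup k] [Module R k] (d : ℕ)
    (hkA : ∀ (i : ℕ) (ι : Type), i < d → EV R i k (ι →₀ A)) (n : ℕ) :
    ∀ (B : Type) [AddCommGroup B] [Module A B] [Module R B] [IsScalarTower R A B],
      pdLE A n (ModuleCat.of A B) → ∀ i, i + n < d → EV R i k B := by
  induction n with
  | zero =>
    intro B _ _ _ _ hB i hi
    have hB' : Module.Projective A B := hB
    obtain ⟨s, hs⟩ := hB'.out
    refine ev_retract_right i (s.restrictScalars R)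
      ((Finsupp.linearCombination A (id : B → B)).restrictScalars R) ?_ (hkA i B hi)
    ext x
    exact hs x
  | succ n ih =>
    rintro B _ _ _ _ ⟨ι, f, hf, hK⟩ i hi
    let f' : (ι →₀ A) →ₗ[A] B := f
    exact co3 (f := (LinearMap.ker f').subtype.restrictScalars R)
      (g := f'.restrictScalars R) (LinearMap.ker f').subtype_injective
      (LinearMap.exact_subtype_ker_map f') hf (hkA i ι (by omega))
      (ih (LinearMap.ker f') hK (i+1) (by omega))

end alg
end GDim

namespace GDim

section final

theorem ev_of_depth {R N : Type} [CommRing R] [IsLocalRing R] [AddCommGroup N] [Module R N]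
    {d : ℕ} (h : moduleDepth R N = d) (i : ℕ) (hi : i < d) : EV R i (ResidueField R) N := by
  apply bridge
  by_contra hne
  have h1 : moduleDepth R N ≤ (i : ℕ∞) := sInf_le ⟨i, rfl, not_subsingleton_iff_nontrivial.1 hne⟩
  rw [h] at h1
  have : d ≤ i := by exact_mod_cast h1
  omega

theorem nontrivial_of_depth {R N : Type} [CommRing R] [IsLocalRing R] [AddCommGroup N]
    [Module R N] {d : ℕ} (h : moduleDepth R N = d) : Nontrivial N := by
  by_contra hne
  have : Subsingleton N := not_nontrivial_iff_subsingleton.1 hne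
  have h1 : moduleDepth R N = ⊤ := by
    rw [moduleDepth, sInf_eq_top]
    rintro _ ⟨n, rfl, hn⟩
    exact absurd (bridge_triv n) (not_subsingleton_iff_nontrivial.2 hn)
  rw [h] at h1
  exact ENat.natCast_ne_top d h1

/-- the submodule `𝔪 M` of `M` over its endomorphism ring -/
def mSub (R M : Type) [CommRing R] [IsLocalRing R] [AddCommGroup M] [Module R M] :
    Submodule (Module.End R M) M where
  carrier := (maximalIdeal R • (⊤ : Submodule R M) : Submodule R M)
  add_mem' := fun ha hb => Submodule.add_mem _ ha hb
  zero_mem' := Submodule.zero_mem _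
  smul_mem' := fun a x hx => by
    have h1 : a x ∈ (maximalIdeal R • (⊤ : Submodule R M)).map a := Submodule.mem_map_of_mem hx
    rw [Submodule.map_smul''] at h1
    exact Submodule.smul_mono le_rfl le_top h1

theorem mem_mSub {R M : Type} [CommRing R] [IsLocalRing R] [AddCommGroup M] [Module R M] (x : M) :
    x ∈ mSub R M ↔ x ∈ (maximalIdeal R • (⊤ : Submodule R M) : Submodule R M) := Iff.rfl

theorem exists_hom {R M : Type} [CommRing R] [IsLocalRing R] [AddCommGroup M] [Module R M]
    [Module.Finite R M] [Nontrivial M] : ¬ EV R 0 (ResidueField R) (M ⧸ mSub R M) := by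
  intro h
  rw [ev_zero] at h
  have hne : mSub R M ≠ ⊤ := by
    intro htop
    have h1 : (⊤ : Submodule R M) ≤ maximalIdeal R • (⊤ : Submodule R M) := fun x _ => by
      have : x ∈ mSub R M := htop ▸ trivial
      exact (mem_mSub x).1 this
    have := Submodule.eq_bot_of_le_smul_of_le_jacobson_bot (maximalIdeal R) ⊤
      Module.Finite.fg_top h1 (IsLocalRing.maximalIdeal_le_jacobson _)
    exact top_ne_bot this
  have : Nontrivial (M ⧸ mSub R M) := Submodule.Quotient.nontrivial_iff.2 hne
  obtain ⟨b, hb⟩ := exists_ne (0 : M ⧸ mSub R M)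
  have hker : maximalIdeal R ≤ LinearMap.ker (LinearMap.toSpanSingleton R (M ⧸ mSub R M) b) := by
    intro r hr
    obtain ⟨x, rfl⟩ := Submodule.Quotient.mk_surjective _ b
    rw [LinearMap.mem_ker, LinearMap.toSpanSingleton_apply, ← Submodule.Quotient.mk_smul]
    refine (Submodule.Quotient.mk_eq_zero _).2 ?_
    exact (mem_mSub _).2 (Submodule.smul_mem_smul hr trivial)
  let φ : ResidueField R →ₗ[R] (M ⧸ mSub R M) := Submodule.liftQ (maximalIdeal R) _ hker
  have h0 : φ = 0 := h.elim _ _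
  apply hb
  have h1 : φ (Submodule.Quotient.mk (1 : R)) = (1 : R) • b := rfl
  rw [h0, one_smul] at h1
  exact h1.symm

end final
end GDim

/-- (Van den Bergh)  Let `R` be a Gorenstein normal local domain of dimension `d` and `M`
a maximal Cohen-Macaulay module such that `A = Hom_R(M, M)` is also maximal
Cohen-Macaulay.  If `A` has finite global dimension, then its global dimension is exactly
`d`. -/
theorem globalDimension_eq_dim_of_finite
    (R : Type) [CommRing R] [IsLocalRing R] [IsDomain R] [IsIntegrallyClosed R]
    (hGor : IsGorensteinLocalRing R)
    (d : ℕ) (hdim : ringKrullDim R = d)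
    (M : Type) [AddCommGroup M] [Module R M] (hM : IsMCM R M)
    (hA : IsMCM R (M →ₗ[R] M))
    (hfin : globalDimension (Module.End R M) ≠ ⊤) :
    globalDimension (Module.End R M) = (d : ℕ∞) := by
  have hN : IsNoetherianRing R := hGor.1
  have hMf : Module.Finite R M := hM.1
  have hAf : Module.Finite R (Module.End R M) := hA.1
  have hMd : moduleDepth R M = d := by
    have := hM.2
    rw [hdim] at this
    exact_mod_cast this
  have hAd : moduleDepth R (Module.End R M) = d := by
    have := hA.2
    rw [hdim] at this
    exact_mod_cast this
  have hnt : Nontrivial M := GDim.nontrivial_of_depth hMd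
  have hk : ∀ i, d < i → GDim.EV R i (ResidueField R) R := fun i hi =>
    GDim.bridge i (hGor.2.2.1 i (by
      rw [hdim]
      intro h
      have : i = d := by exact_mod_cast h
      omega))
  have hR : ∀ (L : Type) [AddCommGroup L] [Module R L] (i : ℕ), d < i → GDim.EV R i L R :=
    fun L _ _ i hi => GDim.injdim' d R (fun L _ _ _ => GDim.bass R d hk L (d+1) (by omega)) L i hi
  have hRI : ∀ (I L : Type) [AddCommGroup L] [Module R L] (i : ℕ), d < i →
      GDim.EV R i L (I →₀ R) :=
    fun I L _ _ i hi => GDim.injdim' d (I →₀ R)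
      (fun L _ _ _ => GDim.ev_directSum I (d+1) L (GDim.bass R d hk L (d+1) (by omega))) L i hi
  have hMR : ∀ i, GDim.EV R (i+1) M R := fun i =>
    GDim.depth_shift R d hk d M (GDim.ev_of_depth hMd) (i+1) (by omega)
  have hAR : ∀ i, GDim.EV R (i+1) (Module.End R M) R := fun i =>
    GDim.depth_shift R d hk d _ (GDim.ev_of_depth hAd) (i+1) (by omega)
  have hinj := GDim.refl_inj d hR M hMR
  obtain ⟨tr, -, htr⟩ := GDim.exists_tr R M
  have hnd := GDim.perfect_nondeg hinj tr htr
  have hsurj := GDim.perfect_surj hinj (GDim.refl_surj d hR M hMR) tr htr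
  have hARI : ∀ (i : ℕ) (ι I : Type), GDim.EV R (i+1) (ι →₀ Module.End R M) (I →₀ R) :=
    fun i ι I => GDim.ev_sum_left ι i _ (GDim.ev_directSum I (i+1) _ (hAR i))
  have hkA : ∀ (i : ℕ) (ι : Type), i < d →
      GDim.EV R i (ResidueField R) (ι →₀ Module.End R M) :=
    fun i ι hi => GDim.ev_directSum ι i _ (GDim.ev_of_depth hAd i hi)
  have hlow : ∀ n : ℕ, (∀ N : ModuleCat.{0} (Module.End R M), pdLE (Module.End R M) n N) →
      d ≤ n := by
    intro n hn
    by_contra hlt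
    exact GDim.exists_hom (GDim.lower (ResidueField R) d hkA n (M ⧸ GDim.mSub R M)
      (hn _) 0 (by omega))
  have hdesc : ∀ j : ℕ, (∀ N : ModuleCat.{0} (Module.End R M), pdLE (Module.End R M) (d+j) N) →
      ∀ N : ModuleCat.{0} (Module.End R M), pdLE (Module.End R M) d N := by
    intro j
    induction j with
    | zero => exact fun h => h
    | succ j ih =>
      intro h
      refine ih fun N => ?_
      let _ : Module R N := Module.compHom N (algebraMap R (Module.End R M))
      have : IsScalarTower R (Module.End R M) N := ⟨fun r a x => by
        rw [Algebra.smul_def, mul_smul]; rfl⟩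
      exact GDim.descend tr hnd hsurj hARI (d+j) N
        (fun I => hRI I N _ (by omega)) (h N)
  apply le_antisymm
  · have hne : ∃ n : ℕ, ∀ N : ModuleCat.{0} (Module.End R M), pdLE (Module.End R M) n N := by
      by_contra hno
      push Not at hno
      apply hfin
      rw [globalDimension, sInf_eq_top]
      rintro _ ⟨n, rfl, hn⟩
      obtain ⟨N, hN'⟩ := hno n
      exact absurd (hn N) hN'
    obtain ⟨n, hn⟩ := hne
    obtain ⟨j, rfl⟩ := Nat.exists_eq_add_of_le (hlow n hn)
    exact sInf_le ⟨d, rfl, hdesc j hn⟩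
  · refine le_sInf ?_
    rintro _ ⟨n, rfl, hn⟩
    exact_mod_cast hlow n hn
end

section
/- Let S be a 2-dimensional complete regular local ring and R = S/(f_1⋯f_n) with each f_i a prime element not lying in m^2 and the f_i pairwise non-associate. Set S_i = S/(f_1⋯f_i) for 1 ≤ i ≤ n and S^ω = ⊕_{i=1}^n S_i. Then for all i, j, Ext_R^1(S_i, S_j) = 0; i.e., S^ω is a rigid object of MCM(R). -/
open CategoryTheory Opposite IsLocalRing

def IsRegularLocalTwoDim (S : Type) [CommRing S] [IsLocalRing S] : Prop :=
  IsNoetherianRing S ∧ ringKrullDim S = 2 ∧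
    ∃ x y : S, IsLocalRing.maximalIdeal S = Ideal.span {x, y}

noncomputable def perMul {R : Type} [CommRing R] (a : R) : ModuleCat.of R R ⟶ ModuleCat.of R R :=
  ModuleCat.ofHom (LinearMap.mulLeft R a)

theorem perMul_comp {R : Type} [CommRing R] (a b : R) (hab : a * b = 0) :
    perMul a ≫ perMul b = 0 := by
  ext
  simp [perMul, mul_comm b a, hab]

noncomputable def perComplex {R : Type} [CommRing R] (a b : R) (hab : a * b = 0) :
    ChainComplex (ModuleCat R) ℕ :=
  HomologicalComplex.alternatingConst (ModuleCat.of R R) (φ := perMul b) (ψ := perMul a)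
    (perMul_comp b a (by rw [mul_comm, hab])) (perMul_comp a b hab)
    fun _ _ => ComplexShape.down_nat_odd_add

theorem perComplex_d_even {R : Type} [CommRing R] (a b : R) (hab : a * b = 0) (m : ℕ) (hm : Even m) :
    (perComplex a b hab).d (m + 1) m = perMul a := by
  have h2 : ¬ Even (m + 1) := by simpa [Nat.even_add_one] using hm
  simp only [perComplex, HomologicalComplex.alternatingConst]
  rw [dif_pos (by simp), dif_neg h2]

theorem perComplex_d_odd {R : Type} [CommRing R] (a b : R) (hab : a * b = 0) (m : ℕ) (hm : ¬ Even m) :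
    (perComplex a b hab).d (m + 1) m = perMul b := by
  have h2 : Even (m + 1) := by simpa [Nat.even_add_one] using hm
  simp only [perComplex, HomologicalComplex.alternatingConst]
  rw [dif_pos (by simp), dif_pos h2]

noncomputable def perAug {R : Type} [CommRing R] (a : R) :
   ModuleCat.of R R ⟶ ModuleCat.of R (R ⧸ Ideal.span {a}) :=
  ModuleCat.ofHom (Submodule.mkQ (Ideal.span {a}))

theorem perMul_aug {R : Type} [CommRing R] (a : R) : perMul a ≫ perAug a = 0 := by
  ext
  simp only [perMul, perAug, ModuleCat.hom_comp, ModuleCat.hom_ofHom, LinearMap.comp_apply]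
  refine (Submodule.Quotient.mk_eq_zero _).2 ?_
  simp

noncomputable def perπ {R : Type} [CommRing R] (a b : R) (hab : a * b = 0) :
    perComplex a b hab ⟶ (ChainComplex.single₀ (ModuleCat R)).obj (ModuleCat.of R (R ⧸ Ideal.span {a})) :=
  ((perComplex a b hab).toSingle₀Equiv _).symm ⟨perAug a, by
    rw [perComplex_d_even a b hab 0 (by simp)]; exact perMul_aug a⟩

theorem perMul_exact {R : Type} [CommRing R] (a b : R) (hab : a * b = 0)
    (hb : ∀ x, b * x = 0 → a ∣ x) (w) : (ShortComplex.mk (perMul a) (perMul b) w).Exact := by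
  rw [ShortComplex.moduleCat_exact_iff]
  intro x hx
  obtain ⟨y, hy⟩ := hb x hx
  exact ⟨y, hy.symm⟩

theorem exact_congr_fg {R : Type} [CommRing R] {X Y Z : ModuleCat R} {f f' : X ⟶ Y} {g g' : Y ⟶ Z}
   (hf : f = f') (hg : g = g') (w : f ≫ g = 0) (w' : f' ≫ g' = 0) (h : (ShortComplex.mk f' g' w').Exact) :
   (ShortComplex.mk f g w).Exact := by
  subst hf; subst hg; exact h

theorem perQuasi {R : Type} [CommRing R] (a b : R) (hab : a * b = 0)
    (ha : ∀ x, a * x = 0 → b ∣ x) (hb : ∀ x, b * x = 0 → a ∣ x) : QuasiIso (perπ a b hab) where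
  quasiIsoAt m := by
    induction m with
    | zero =>
      rw [ChainComplex.quasiIsoAt₀_iff, ShortComplex.quasiIso_iff_of_zeros' _ rfl rfl rfl]
      have hf0 : (perπ a b hab).f 0 = perAug a := by
        simp [perπ, ChainComplex.toSingle₀Equiv]
        try rfl
      constructor
      · refine exact_congr_fg (perComplex_d_even a b hab 0 (by simp)) hf0 _ (perMul_aug a) ?_
        rw [ShortComplex.moduleCat_exact_iff]
        intro x hx
        obtain ⟨y, hy⟩ := Ideal.mem_span_singleton.1 ((Submodule.Quotient.mk_eq_zero _).1 hx)
        exact ⟨y, hy.symm⟩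
      · change Epi ((perπ a b hab).f 0)
        rw [hf0]
        exact (ModuleCat.epi_iff_surjective _).2 (Submodule.mkQ_surjective _)
    | succ m _ =>
      rw [quasiIsoAt_iff_exactAt' (hL := ChainComplex.exactAt_succ_single_obj ..),
          HomologicalComplex.exactAt_iff' _ (m + 2) (m + 1) m (by simp) (by simp)]
      by_cases hm : Even m
      · exact exact_congr_fg (perComplex_d_odd a b hab (m+1) (by simpa [Nat.even_add_one] using hm))
          (perComplex_d_even a b hab m hm) _ (perMul_comp b a (by rw [mul_comm, hab])) (perMul_exact b a (by rw [mul_comm, hab]) ha _)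
      · exact exact_congr_fg (perComplex_d_even a b hab (m+1) (by simpa [Nat.even_add_one] using hm))
          (perComplex_d_odd a b hab m hm) _ (perMul_comp a b hab) (perMul_exact a b hab hb _)

theorem ext_aux (R : Type) [CommRing R] (a b : R) (hab : a * b = 0)
    (ha : ∀ x, a * x = 0 → b ∣ x) (hb : ∀ x, b * x = 0 → a ∣ x)
    (N : Type) [AddCommGroup N] [Module R N] (hN : ∀ n : N, b • n = 0 → ∃ m : N, n = a • m) :
    Subsingleton (ExtGroup R 1 (R ⧸ Ideal.span {a}) N) := by
  let P : ProjectiveResolution (ModuleCat.of R (R ⧸ Ideal.span {a})) :=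
    { complex := perComplex a b hab
      projective := fun _ => (inferInstance : Projective (ModuleCat.of R R))
      π := perπ a b hab
      quasiIso := perQuasi a b hab ha hb }
  apply ModuleCat.subsingleton_of_isZero
  refine Limits.IsZero.of_iso ?_ (P.isoExt (R := R) 1 (ModuleCat.of R N))
  rw [← HomologicalComplex.exactAt_iff_isZero_homology,
    HomologicalComplex.exactAt_iff' _ 0 1 2 (by simp) (by simp),
    ShortComplex.moduleCat_exact_iff]
  intro (x : ModuleCat.of R R ⟶ ModuleCat.of R N) hx
  have h1 : (perComplex a b hab).d 1 0 = perMul a := perComplex_d_even a b hab 0 (by simp)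
  have h2 : (perComplex a b hab).d 2 1 = perMul b := perComplex_d_odd a b hab 1 (by simp)
  have hx' : (perComplex a b hab).d 2 1 ≫ x = 0 := hx
  rw [h2] at hx'
  have hx1 : b • x.hom 1 = 0 := by
    have := congrArg (fun g : ModuleCat.of R R ⟶ ModuleCat.of R N => g.hom (1 : R)) hx'
    rw [← map_smul]
    have h : x.hom (b * (1 : R)) = 0 := this
    exact h
  obtain ⟨m, hm⟩ := hN _ hx1
  let y : ModuleCat.of R R ⟶ ModuleCat.of R N := ModuleCat.ofHom (LinearMap.toSpanSingleton R N m)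
  refine ⟨y, ?_⟩
  change (perComplex a b hab).d 1 0 ≫ y = x
  rw [h1]
  ext
  change (a * (1 : R)) • m = x.hom (1 : R)
  rw [mul_one, hm]

theorem dom_aux (S : Type) [CommRing S] [IsLocalRing S] [IsNoetherianRing S]
  (hd : ringKrullDim S = 2) (x y : S) (hxy : maximalIdeal S = Ideal.span {x, y})
  (f : S) (hf : f ∈ maximalIdeal S) (hf2 : f ∉ maximalIdeal S ^ 2) : IsDomain S := by
  have hh : (maximalIdeal S).height = 2 := by
    have := IsLocalRing.maximalIdeal_height_eq_ringKrullDim (R := S)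
    rw [hd] at this
    have h2 : (((maximalIdeal S).height : ℕ∞) : WithBot ℕ∞) = ((2 : ℕ∞) : WithBot ℕ∞) := this
    exact WithBot.coe_injective h2
  have hjac : maximalIdeal S ≤ Ideal.jacobson ⊥ := (IsLocalRing.jacobson_eq_maximalIdeal ⊥ bot_ne_top).ge
  -- avoidance
  obtain ⟨z, hzm, hz2, hzq⟩ : ∃ z ∈ maximalIdeal S, z ∉ maximalIdeal S ^ 2 ∧
      ∀ q ∈ minimalPrimes S, z ∉ q := by
    classical
    by_contra! hcon
    have hfin := minimalPrimes.finite_of_isNoetherianRing S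
    let s : Finset (Ideal S) := insert (maximalIdeal S ^ 2) hfin.toFinset
    have := (Ideal.subset_union_prime (s := s) (f := id) (maximalIdeal S ^ 2) (maximalIdeal S ^ 2)
      (I := maximalIdeal S) (by
        intro i hi hne _
        have : i ∈ minimalPrimes S := by simpa [s, hne] using hi
        exact this.1.1)).1 (by
        intro z hz
        by_cases h2 : z ∈ maximalIdeal S ^ 2
        · exact Set.mem_biUnion (show maximalIdeal S ^ 2 ∈ (s : Set (Ideal S)) by simp [s]) h2
        · obtain ⟨q, hq, hzq⟩ := hcon z hz h2
          exact Set.mem_biUnion (show q ∈ (s : Set (Ideal S)) by simp [s, hq]) hzq)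
    obtain ⟨i, hi, hle⟩ := this
    by_cases hne : i = maximalIdeal S ^ 2
    · subst hne; exact hf2 (hle hf)
    · have hi : i ∈ minimalPrimes S := by simpa [s, hne] using hi
      have hp : i.IsPrime := hi.1.1
      have h0 : i.height = 0 := by
        exact Ideal.height_eq_zero_iff.2 hi
      have : (maximalIdeal S).height ≤ i.height := Ideal.height_mono hle
      rw [h0, hh] at this
      simp at this
  obtain ⟨w, hw⟩ : ∃ w, maximalIdeal S = Ideal.span {z, w} := by
    have hx : x ∈ maximalIdeal S := hxy ▸ Ideal.subset_span (by simp)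
    have hy : y ∈ maximalIdeal S := hxy ▸ Ideal.subset_span (by simp)
    obtain ⟨a, b, hab⟩ := Ideal.mem_span_pair.1 (hxy ▸ hzm)
    by_cases ha : IsUnit a
    · obtain ⟨a, rfl⟩ := ha
      refine ⟨y, le_antisymm ?_ ?_⟩
      · rw [hxy, Ideal.span_le]
        rintro t (rfl | rfl)
        · refine Ideal.mem_span_pair.2 ⟨↑a⁻¹, -(↑a⁻¹ * b), ?_⟩
          rw [← hab]; linear_combination (t) * a.inv_mul
        · exact Ideal.subset_span (by simp)
      · rw [Ideal.span_le]; rintro t (rfl | rfl) <;> assumption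
    by_cases hb : IsUnit b
    · obtain ⟨b, rfl⟩ := hb
      refine ⟨x, le_antisymm ?_ ?_⟩
      · rw [hxy, Ideal.span_le]
        rintro t (rfl | rfl)
        · exact Ideal.subset_span (by simp)
        · refine Ideal.mem_span_pair.2 ⟨↑b⁻¹, -(↑b⁻¹ * a), ?_⟩
          rw [← hab]; linear_combination (t) * b.inv_mul
      · rw [Ideal.span_le]; rintro t (rfl | rfl) <;> assumption
    · exfalso; apply hz2
      rw [← hab, pow_two]
      exact add_mem (Ideal.mul_mem_mul ha hx) (Ideal.mul_mem_mul hb hy)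
  have hwm : w ∈ maximalIdeal S := hw ▸ Ideal.subset_span (by simp)
  obtain ⟨p, hp⟩ := (Ideal.span {z}).nonempty_minimalPrimes (by simpa using hzm)
  have hp1 := Ideal.height_le_one_of_isPrincipal_of_mem_minimalPrimes (Ideal.span {z}) _ hp
  have hpp : p.IsPrime := hp.1.1
  have hzp : z ∈ p := hp.1.2 (Ideal.mem_span_singleton_self z)
  have hwp : w ∉ p := by
    intro h
    have : maximalIdeal S ≤ p := by
      rw [hw, Ideal.span_le]; rintro t (rfl | rfl) <;> assumption
    have := Ideal.height_mono this
    rw [hh] at this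
    have := this.trans hp1
    norm_num at this
  have hpz : p ≤ Ideal.span {z} := by
    refine Submodule.le_of_le_smul_of_le_jacobson_bot (IsNoetherian.noetherian p) hjac ?_
    intro t ht
    obtain ⟨a, b, hab⟩ := Ideal.mem_span_pair.1 (hw ▸ (IsLocalRing.le_maximalIdeal hpp.ne_top ht))
    have hb : b * w ∈ p := by
      have : b * w = t - a * z := by rw [← hab]; ring
      rw [this]; exact sub_mem ht (p.mul_mem_left _ hzp)
    have hb := (hpp.mem_or_mem hb).resolve_right hwp
    rw [← hab]
    refine Submodule.add_mem_sup (Ideal.mem_span_singleton'.2 ⟨a, rfl⟩) ?_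
    rw [mul_comm]
    exact Submodule.smul_mem_smul hwm hb
  obtain ⟨q, hq, hqp⟩ := Ideal.exists_minimalPrimes_le (I := (⊥ : Ideal S)) (J := p) bot_le
  have hqq : q.IsPrime := hq.1.1
  have hzq := hzq q hq
  have : q = ⊥ := by
    refine Submodule.eq_bot_of_le_smul_of_le_jacobson_bot (maximalIdeal S) q (IsNoetherian.noetherian q) ?_ hjac
    intro t ht
    obtain ⟨a, rfl⟩ := Ideal.mem_span_singleton'.1 (hpz (hqp ht))
    rw [mul_comm]
    exact Submodule.smul_mem_smul hzm ((hqq.mem_or_mem ht).resolve_right hzq)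
  subst this
  exact IsDomain.of_bot_isPrime S

theorem prod_cop {S : Type} [CommRing S] [IsDomain S] {ι : Type} (f : ι → S)
    (hprime : ∀ i, Prime (f i)) (hassoc : ∀ i j, i ≠ j → ¬Associated (f i) (f j))
    (s t : Finset ι) (hst : ∀ k ∈ s, k ∉ t) (x : S)
    (h : (∏ k ∈ s, f k) ∣ (∏ k ∈ t, f k) * x) : (∏ k ∈ s, f k) ∣ x := by
  classical
  induction s using Finset.induction_on generalizing x with
  | empty => simp
  | insert k s hk ih =>
    rw [Finset.prod_insert hk] at h ⊢
    have hkt : ¬ f k ∣ ∏ k ∈ t, f k := by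
      intro hd
      obtain ⟨l, hl, hd⟩ := ((hprime k).dvd_finsetProd_iff _).1 hd
      have := ((hprime k).dvd_prime_iff_associated (hprime l)).1 hd
      refine hassoc k l ?_ this
      rintro rfl
      exact hst k (by simp) hl
    obtain ⟨y, rfl⟩ := ((hprime k).dvd_or_dvd ((dvd_mul_right _ _).trans h)).resolve_left hkt
    refine mul_dvd_mul_left _ (ih (fun l hl => hst l (by simp [hl])) y ?_)
    rw [mul_left_comm] at h
    exact (mul_dvd_mul_iff_left (hprime k).ne_zero).1 h

theorem mk_dvd_aux {S : Type} [CommRing S] (F C t : S) (hC : C ∣ F)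
    (h : Ideal.Quotient.mk (Ideal.span {F}) C ∣ Ideal.Quotient.mk (Ideal.span {F}) t) : C ∣ t := by
  obtain ⟨s, hs⟩ := h
  obtain ⟨s, rfl⟩ := Ideal.Quotient.mk_surjective s
  rw [← map_mul, Ideal.Quotient.eq, Ideal.mem_span_singleton] at hs
  have := dvd_add (hC.trans hs) (dvd_mul_right C s)
  simpa using this

/-- Let `S` be a `2`-dimensional complete regular local ring and `R = S/(f_1⋯f_n)` with
the `f_i` pairwise non-associate primes, each `f_i ∉ m²`.  Set `S_i = S/(f_1⋯f_i)`
(realized as `R/(f_1⋯f_i)`).  Then `Ext_R^1(S_i, S_j) = 0` for all `i, j`; i.e.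
`S^ω = ⊕ S_i` is rigid. -/
theorem ext_one_Si_Sj_vanishes
    (S : Type) [CommRing S] [IsLocalRing S] (hS : IsRegularLocalTwoDim S)
    (hcomp : IsAdicComplete (IsLocalRing.maximalIdeal S) S)
    (n : ℕ) (f : Fin n → S) (hprime : ∀ i, Prime (f i))
    (hassoc : ∀ i j, i ≠ j → ¬Associated (f i) (f j))
    (hm2 : ∀ i, f i ∉ (IsLocalRing.maximalIdeal S) ^ 2)
    [IsLocalRing (S ⧸ Ideal.span {∏ i, f i})]
    (i j : Fin n) :
    Subsingleton (ExtGroup (S ⧸ Ideal.span {∏ i, f i}) 1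
      ((S ⧸ Ideal.span {∏ i, f i}) ⧸
        Ideal.span {Ideal.Quotient.mk (Ideal.span {∏ i, f i}) (∏ k ∈ Finset.Iic i, f k)})
      ((S ⧸ Ideal.span {∏ i, f i}) ⧸
        Ideal.span {Ideal.Quotient.mk (Ideal.span {∏ i, f i}) (∏ k ∈ Finset.Iic j, f k)})) := by
  obtain ⟨hN, hd, x, y, hxy⟩ := hS
  have : IsDomain S := dom_aux S hd x y hxy (f i) (by simpa using (hprime i).not_unit) (hm2 i)
  have hF : ∀ l : Fin n, (∏ k ∈ Finset.Iic l, f k) * (∏ k ∈ Finset.Ioi l, f k) = ∏ k, f k := by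
    intro l
    rw [← Finset.prod_mul_prod_compl (Finset.Iic l)]
    congr 2
    ext k; simp
  have hne : ∀ s : Finset (Fin n), ∏ k ∈ s, f k ≠ 0 := fun s =>
    Finset.prod_ne_zero_iff.2 fun k _ => (hprime k).ne_zero
  refine ext_aux _ _ (Ideal.Quotient.mk _ (∏ k ∈ Finset.Ioi i, f k)) ?_ ?_ ?_ _ ?_
  · rw [← map_mul, hF, Ideal.Quotient.eq_zero_iff_mem]
    exact Ideal.mem_span_singleton_self _
  · intro x hx
    obtain ⟨x, rfl⟩ := Ideal.Quotient.mk_surjective x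
    rw [← map_mul, Ideal.Quotient.eq_zero_iff_mem, Ideal.mem_span_singleton, ← hF i,
      mul_dvd_mul_iff_left (hne _)] at hx
    exact map_dvd _ hx
  · intro x hx
    obtain ⟨x, rfl⟩ := Ideal.Quotient.mk_surjective x
    rw [← map_mul, Ideal.Quotient.eq_zero_iff_mem, Ideal.mem_span_singleton, ← hF i,
      mul_comm, mul_dvd_mul_iff_left (hne _)] at hx
    exact map_dvd _ hx
  · intro t ht
    obtain ⟨t, rfl⟩ := Ideal.Quotient.mk_surjective t
    obtain ⟨t, rfl⟩ := Ideal.Quotient.mk_surjective t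
    have ht' : Ideal.Quotient.mk (Ideal.span {Ideal.Quotient.mk (Ideal.span {∏ i, f i})
        (∏ k ∈ Finset.Iic j, f k)}) (Ideal.Quotient.mk (Ideal.span {∏ i, f i})
          ((∏ k ∈ Finset.Ioi i, f k) * t)) = 0 := ht
    rw [Ideal.Quotient.eq_zero_iff_mem, Ideal.mem_span_singleton] at ht'
    have h1 := mk_dvd_aux _ _ _ ⟨_, (hF j).symm⟩ ht'
    rcases le_total i j with hij | hij
    · have hC : ∏ k ∈ Finset.Iic j, f k =
          (∏ k ∈ Finset.Ioc i j, f k) * ∏ k ∈ Finset.Iic i, f k := by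
        rw [← Finset.prod_union]
        · congr 1; ext k; simp <;> grind
        · rw [Finset.disjoint_left]; intro k; simp <;> grind
      have hB : ∏ k ∈ Finset.Ioi i, f k =
          (∏ k ∈ Finset.Ioc i j, f k) * ∏ k ∈ Finset.Ioi j, f k := by
        rw [← Finset.prod_union]
        · congr 1; ext k; simp <;> grind
        · rw [Finset.disjoint_left]; intro k; simp <;> grind
      rw [hC, hB, mul_assoc, mul_dvd_mul_iff_left (hne _)] at h1
      obtain ⟨s, hs⟩ := prod_cop f hprime hassoc _ _ (by intro k; simp <;> grind) t h1
      refine ⟨Ideal.Quotient.mk _ (Ideal.Quotient.mk _ s), ?_⟩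
      rw [hs]
      rfl
    · obtain ⟨s, hs⟩ := prod_cop f hprime hassoc _ _ (by intro k; simp <;> grind) t h1
      refine ⟨0, ?_⟩
      rw [smul_zero, Ideal.Quotient.eq_zero_iff_mem, Ideal.mem_span_singleton]
      exact map_dvd _ ⟨s, hs⟩
end

section
/- Let S be a 2-dimensional complete regular local ring, f, g elements with g a prime not in m^2, R = S/(hg) for some h, and M a maximal Cohen-Macaulay R-module with Ext_R^1(R/(h), M) = 0. Then hM is a free R/(g)-module, and if ha_1,…,ha_l is a minimal generating set of hM, the submodule N = (a_1,…,a_l) of M generated by a_1,…,a_l is a free R-module. -/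
open CategoryTheory Opposite IsLocalRing

def IsMCM1 (R : Type) [CommRing R] [IsLocalRing R]
    (M : Type) [AddCommGroup M] [Module R M] : Prop :=
  Module.Finite R M ∧ moduleDepth R M = 1


lemma aux_prime_le {S : Type} [CommRing S] [IsLocalRing S] [IsNoetherianRing S] (g t : S)
    (hm : maximalIdeal S = Ideal.span {g, t}) (Q : Ideal S) [Q.IsPrime] (hgQ : g ∈ Q)
    (hQ : Q ≠ maximalIdeal S) : Q ≤ Ideal.span {g} := by
  have htm : t ∈ maximalIdeal S := by rw [hm]; exact Ideal.subset_span (by simp)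
  have htQ : t ∉ Q := fun ht => hQ (le_antisymm (le_maximalIdeal (Ideal.IsPrime.ne_top')) (by
    rw [hm, Ideal.span_le]; rintro z (rfl | rfl) <;> assumption))
  refine Submodule.le_of_le_smul_of_le_jacobson_bot (I := maximalIdeal S)
    (IsNoetherian.noetherian Q) (maximalIdeal_le_jacobson _) ?_
  intro z hz
  have hzm : z ∈ maximalIdeal S := le_maximalIdeal (Ideal.IsPrime.ne_top') hz
  rw [hm, Ideal.mem_span_pair] at hzm
  obtain ⟨a, b, rfl⟩ := hzm
  have hb : b ∈ Q := by
    have : b * t ∈ Q := by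
      have := Q.sub_mem hz (Q.mul_mem_left a hgQ)
      simpa using this
    exact (Ideal.IsPrime.mem_or_mem ‹_› this).resolve_right htQ
  refine Submodule.add_mem_sup (Ideal.mem_span_singleton'.2 ⟨a, rfl⟩) ?_
  rw [mul_comm]
  exact Submodule.smul_mem_smul htm hb

lemma aux_domain {S : Type} [CommRing S] [IsLocalRing S] [IsNoetherianRing S] (g t : S)
    (hm : maximalIdeal S = Ideal.span {g, t}) (hdim : ringKrullDim S = 2) : IsDomain S := by
  have hgm : g ∈ maximalIdeal S := by rw [hm]; exact Ideal.subset_span (by simp)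
  obtain ⟨p, hp⟩ := Order.le_krullDim_iff.1 (show ((2 : ℕ) : WithBot ℕ∞) ≤ Order.krullDim (PrimeSpectrum S) from hdim.ge)
  obtain ⟨P0, P1, P2, h01, h12⟩ : ∃ P0 P1 P2 : PrimeSpectrum S, P0 < P1 ∧ P1 < P2 :=
    ⟨p ⟨0, by omega⟩, p ⟨1, by omega⟩, p ⟨2, by omega⟩, p.strictMono (Fin.mk_lt_mk.2 (by omega)),
      p.strictMono (Fin.mk_lt_mk.2 (by omega))⟩
  have hP0 := P0.2
  have hP1 := P1.2
  have h01' : P0.asIdeal < P1.asIdeal := h01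
  have h1m : P1.asIdeal < maximalIdeal S := lt_of_lt_of_le (show P1.asIdeal < P2.asIdeal from h12)
    (le_maximalIdeal P2.2.ne_top)
  have hg0 : g ∉ P0.asIdeal := fun hg => by
    have := aux_prime_le g t hm P1.asIdeal (h01'.le hg) h1m.ne
    exact h01'.not_ge (this.trans ((Ideal.span_singleton_le_iff_mem _).2 hg))
  have hle : P0.asIdeal ≤ Ideal.span {g} := by
    have hne : Ideal.span (insert g (P0.asIdeal : Set S)) ≤ maximalIdeal S := by
      rw [Ideal.span_le]
      rintro z (rfl | hz)
      · exact hgm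
      · exact le_maximalIdeal hP0.ne_top hz
    obtain ⟨Q, hQ, -⟩ := Ideal.exists_minimalPrimes_le hne
    have hQp := hQ.1.1
    have hQg : g ∈ Q := hQ.1.2 (Ideal.subset_span (by simp))
    have hQ0 : P0.asIdeal ≤ Q := fun z hz => hQ.1.2 (Ideal.subset_span (by simp [hz]))
    refine hQ0.trans (aux_prime_le g t hm Q hQg ?_)
    rintro rfl
    have := Ideal.mem_minimalPrimes_span_of_mem_minimalPrimes_span_insert h1m g _ hQ
      (P0.asIdeal : Set S) h01'.le
      (fun z hz => Ideal.le_radical (Ideal.subset_span (by right; exact hz)))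
    rw [Ideal.span_eq] at this
    exact h01'.not_ge (this.2 ⟨hP0, le_rfl⟩ h01'.le)
  have hbot : P0.asIdeal ≤ ⊥ := by
    refine Submodule.le_of_le_smul_of_le_jacobson_bot (I := maximalIdeal S)
      (IsNoetherian.noetherian _) (maximalIdeal_le_jacobson _) ?_
    intro z hz
    obtain ⟨a, rfl⟩ := Ideal.mem_span_singleton'.1 (hle hz)
    refine Submodule.mem_sup_right ?_
    rw [mul_comm]
    exact Submodule.smul_mem_smul hgm ((hP0.mem_or_mem hz).resolve_right hg0)
  rw [le_bot_iff] at hbot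
  rw [hbot] at hP0
  exact IsDomain.of_bot_isPrime S

/-- a parameter completing `g` -/
lemma aux_param {S : Type} [CommRing S] [IsLocalRing S] (x y g : S)
    (hm : maximalIdeal S = Ideal.span {x, y}) (hg : g ∈ maximalIdeal S)
    (hg2 : g ∉ maximalIdeal S ^ 2) : ∃ t, maximalIdeal S = Ideal.span {g, t} := by
  have key : ∀ x y : S, maximalIdeal S = Ideal.span {x, y} → ∀ a b, a * x + b * y = g → IsUnit a →
      maximalIdeal S = Ideal.span {g, y} := by
    intro x y hm a b hab ha
    apply le_antisymm
    · conv_lhs => rw [hm]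
      rw [Ideal.span_le]
      rintro z (rfl | rfl)
      · obtain ⟨u, rfl⟩ := ha
        refine Ideal.mem_span_pair.2 ⟨↑u⁻¹, - ↑u⁻¹ * b, ?_⟩
        rw [← hab]
        linear_combination z * u.inv_mul
      · exact Ideal.subset_span (by simp)
    · rw [Ideal.span_le]
      rintro z (rfl | rfl)
      · exact hg
      · rw [hm]; exact Ideal.subset_span (by simp)
  have hg' := hg
  rw [hm, Ideal.mem_span_pair] at hg'
  obtain ⟨a, b, hab⟩ := hg'
  by_cases ha : IsUnit a
  · exact ⟨y, key x y hm a b hab ha⟩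
  by_cases hb : IsUnit b
  · exact ⟨x, key y x (by rw [hm, Set.pair_comm]) b a (by rw [← hab, add_comm]) hb⟩
  exfalso
  apply hg2
  rw [← hab, pow_two]
  have hx : x ∈ maximalIdeal S := by rw [hm]; exact Ideal.subset_span (by simp)
  have hy : y ∈ maximalIdeal S := by rw [hm]; exact Ideal.subset_span (by simp)
  exact add_mem (Ideal.mul_mem_mul ha hx) (Ideal.mul_mem_mul hb hy)

lemma aux_exact {R : Type} [CommRing R] (n : ℕ) (X M : Type) [AddCommGroup X] [Module R X]
    [AddCommGroup M] [Module R M] (he : Subsingleton (ExtGroup R n X M))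
    (P : ProjectiveResolution (ModuleCat.of R X)) :
    (P.complex.linearYonedaObj R (ModuleCat.of R M)).ExactAt n := by
  rw [HomologicalComplex.exactAt_iff_isZero_homology]
  exact (ModuleCat.isZero_of_subsingleton _).of_iso (P.isoExt n (ModuleCat.of R M)).symm

lemma aux_ext0 {R : Type} [CommRing R] (X M : Type) [AddCommGroup X] [Module R X]
    [AddCommGroup M] [Module R M] (he : Subsingleton (ExtGroup R 0 X M)) (f : X →ₗ[R] M) :
    f = 0 := by
  let P := ProjectiveResolution.of (ModuleCat.of R X)
  have h := aux_exact 0 X M he P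
  rw [HomologicalComplex.exactAt_iff' _ 0 0 1 (by simp) (by simp),
    ShortComplex.moduleCat_exact_iff] at h
  let π : P.complex.X 0 →ₗ[R] X := (P.π.f 0).hom
  have hπs : Function.Surjective π := by
    exact (ModuleCat.epi_iff_surjective _).1 (inferInstanceAs (Epi (P.π.f 0)))
  have hπd : ∀ z, π ((P.complex.d 1 0).hom z) = 0 := fun z => by
    have := ConcreteCategory.congr_hom (P.complex_d_comp_π_f_zero) z
    exact this
  obtain ⟨z, hz⟩ := h (ModuleCat.ofHom (f ∘ₗ π) : P.complex.X 0 ⟶ ModuleCat.of R M) (by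
    change P.complex.d 1 0 ≫ ModuleCat.ofHom (f ∘ₗ π) = 0
    ext z
    exact (congrArg f (hπd z)).trans (map_zero f))
  have hd : (P.complex.linearYonedaObj R (ModuleCat.of R M)).d 0 0 = 0 :=
    HomologicalComplex.shape _ _ _ (by simp)
  have hz2 : (P.complex.linearYonedaObj R (ModuleCat.of R M)).d 0 0 z =
    (ModuleCat.ofHom (f ∘ₗ π) : P.complex.X 0 ⟶ ModuleCat.of R M) := hz
  rw [hd] at hz2
  have hz3 : (ModuleCat.ofHom (f ∘ₗ π) : P.complex.X 0 ⟶ ModuleCat.of R M) = 0 := hz2.symm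
  ext x
  obtain ⟨p, rfl⟩ := hπs x
  exact ConcreteCategory.congr_hom hz3 p

lemma aux_ext1 {R : Type} [CommRing R] (h g : R) (hann : ∀ r, h * r = 0 → ∃ s, r = s * g)
    (M : Type) [AddCommGroup M] [Module R M]
    (he : Subsingleton (ExtGroup R 1 (R ⧸ Ideal.span {h}) M)) (x : M) (hx : g • x = 0) :
    ∃ m : M, x = h • m := by
  let X := R ⧸ Ideal.span {h}
  let P := ProjectiveResolution.of (ModuleCat.of R X)
  have hE := aux_exact 1 X M he P
  rw [HomologicalComplex.exactAt_iff' _ 0 1 2 (by simp) (by simp),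
    ShortComplex.moduleCat_exact_iff] at hE
  let π : P.complex.X 0 →ₗ[R] X := (P.π.f 0).hom
  let d1 : P.complex.X 1 →ₗ[R] P.complex.X 0 := (P.complex.d 1 0).hom
  let d2 : P.complex.X 2 →ₗ[R] P.complex.X 1 := (P.complex.d 2 1).hom
  have hE' : ∀ φ : P.complex.X 1 →ₗ[R] M, φ ∘ₗ d2 = 0 → ∃ ψ : P.complex.X 0 →ₗ[R] M,
      φ = ψ ∘ₗ d1 := by
    intro φ hφ
    obtain ⟨ψ, hψ⟩ := hE (ModuleCat.ofHom φ : P.complex.X 1 ⟶ ModuleCat.of R M) (by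
      change P.complex.d 2 1 ≫ ModuleCat.ofHom φ = 0
      ext z
      exact LinearMap.congr_fun hφ z)
    have hψ' : P.complex.d 1 0 ≫ (show P.complex.X 0 ⟶ ModuleCat.of R M from ψ) = ModuleCat.ofHom φ := hψ
    refine ⟨(show P.complex.X 0 ⟶ ModuleCat.of R M from ψ).hom, ?_⟩
    ext z
    have := ConcreteCategory.congr_hom hψ' z
    exact this.symm
  have hdd : ∀ z, d1 (d2 z) = 0 := fun z => by
    have := ConcreteCategory.congr_hom (P.complex.d_comp_d 2 1 0) z
    exact this
  have hπs : Function.Surjective π := by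
    exact (ModuleCat.epi_iff_surjective _).1 (inferInstanceAs (Epi (P.π.f 0)))
  have hπd : ∀ z, π (d1 z) = 0 := fun z => by
    have := ConcreteCategory.congr_hom (P.complex_d_comp_π_f_zero) z
    exact this
  have hπe : ∀ z, π z = 0 → ∃ w, d1 w = z := fun z hz => by
    have := P.exact₀
    rw [ShortComplex.moduleCat_exact_iff] at this
    exact this z hz
  have pr0 : Module.Projective R (P.complex.X 0) :=
    (IsProjective.iff_projective _).2 (inferInstanceAs (Projective (P.complex.X 0)))
  have pr1 : Module.Projective R (P.complex.X 1) :=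
    (IsProjective.iff_projective _).2 (inferInstanceAs (Projective (P.complex.X 1)))
  obtain ⟨q, hq⟩ := Module.projective_lifting_property (Submodule.mkQ (Ideal.span {h})) π
    (Submodule.mkQ_surjective _)
  have hq' : ∀ z, Submodule.mkQ (Ideal.span {h}) (q z) = π z := LinearMap.congr_fun hq
  let mh : R →ₗ[R] Ideal.span {h} := LinearMap.codRestrict _ (LinearMap.mulLeft R h)
    (fun r => Ideal.mem_span_singleton.2 ⟨r, rfl⟩)
  obtain ⟨θ, hθ⟩ := Module.projective_lifting_property mh
    (LinearMap.codRestrict (Ideal.span {h}) (q ∘ₗ d1) (fun z => by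
      rw [← Submodule.Quotient.mk_eq_zero]
      exact (hq' (d1 z)).trans (hπd z))) (by
      rintro ⟨z, hz⟩
      obtain ⟨r, rfl⟩ := Ideal.mem_span_singleton.1 hz
      exact ⟨r, rfl⟩)
  have hθ' : ∀ z, h * θ z = q (d1 z) := fun z => congrArg Subtype.val (LinearMap.congr_fun hθ z)
  have hannx : ∀ r, h * r = 0 → r • x = 0 := fun r hr => by
    obtain ⟨s, rfl⟩ := hann r hr
    rw [mul_smul, hx, smul_zero]
  obtain ⟨ψ, hψ⟩ := hE' (LinearMap.toSpanSingleton R M x ∘ₗ θ) (by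
    ext z
    exact hannx (θ (d2 z)) (by rw [hθ', hdd, map_zero]))
  have hψ' : ∀ z, θ z • x = ψ (d1 z) := LinearMap.congr_fun hψ
  obtain ⟨p0, hp0⟩ := hπs (Submodule.mkQ (Ideal.span {h}) 1)
  obtain ⟨p1, hp1⟩ := hπe (h • p0) (by
    rw [map_smul, hp0, ← map_smul]
    exact (Submodule.Quotient.mk_eq_zero _).2 (Ideal.mem_span_singleton.2 ⟨1, by simp⟩))
  obtain ⟨u, hu⟩ : ∃ u, q p0 - 1 = h * u := by
    have : Submodule.mkQ (Ideal.span {h}) (q p0 - 1) = 0 := by rw [map_sub, hq', hp0, sub_self]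
    exact Ideal.mem_span_singleton.1 ((Submodule.Quotient.mk_eq_zero _).1 this)
  have h1 := hψ' p1
  have h2 := hannx (θ p1 - (1 + h * u)) (by
    rw [mul_sub, hθ', hp1, ← hu, map_smul, smul_eq_mul]; ring)
  rw [hp1, map_smul] at h1
  refine ⟨ψ p0 - u • x, ?_⟩
  rw [smul_sub, ← h1, smul_smul]
  rw [sub_smul, add_smul, one_smul, sub_eq_zero] at h2
  rw [h2]; abel


lemma aux_rel {R : Type} [CommRing R] [IsLocalRing R] [IsNoetherianRing R] (g t : R)
    (hm : maximalIdeal R = Ideal.span {g, t}) {M : Type} [AddCommGroup M] [Module R M]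
    (hsoc : ∀ x : M, g • x = 0 → t • x = 0 → x = 0) {l : ℕ} (w : Fin l → M)
    (hw : ∀ i, g • w i = 0)
    (hmin : ∀ c : Fin l → R, ∑ i, c i • w i = 0 → ∀ i, c i ∈ maximalIdeal R)
    (c : Fin l → R) (hc : ∑ i, c i • w i = 0) (i : Fin l) : c i ∈ Ideal.span {g} := by
  have htm : t ∈ maximalIdeal R := by rw [hm]; exact Ideal.subset_span (by simp)
  have key : LinearMap.ker (Fintype.linearCombination R w) ≤
      Submodule.pi Set.univ (fun _ => (Ideal.span {g} : Submodule R R)) := by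
    refine Submodule.le_of_le_smul_of_le_jacobson_bot (I := maximalIdeal R)
      (IsNoetherian.noetherian _) (maximalIdeal_le_jacobson _) ?_
    intro c hc
    have hc' : ∑ i, c i • w i = 0 := by simpa [Fintype.linearCombination_apply] using hc
    have := hmin c hc'
    simp only [hm, Ideal.mem_span_pair] at this
    choose u v huv using this
    have hcd : c = (fun i => u i * g) + t • v := by
      ext i; simp [← huv i, mul_comm]
    rw [hcd]
    refine Submodule.add_mem_sup ?_ (Submodule.smul_mem_smul htm ?_)
    · intro i _
      exact Ideal.mem_span_singleton'.2 ⟨u i, rfl⟩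
    · rw [LinearMap.mem_ker, Fintype.linearCombination_apply]
      apply hsoc
      · rw [Finset.smul_sum]
        exact Finset.sum_eq_zero fun i _ => by rw [smul_comm, hw, smul_zero]
      · rw [← hc', Finset.smul_sum]
        refine Finset.sum_congr rfl fun i _ => ?_
        rw [← huv i, add_smul, mul_smul, hw, smul_zero, zero_add, mul_comm, mul_smul]
  exact key (x := c) (by rw [LinearMap.mem_ker, Fintype.linearCombination_apply, hc]) i trivial

lemma aux_mingen {R : Type} [CommRing R] [IsLocalRing R] {W : Type} [AddCommGroup W] [Module R W]
    [Module.Finite R W] : ∃ (l : ℕ) (w : Fin l → W), Submodule.span R (Set.range w) = ⊤ ∧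
    ∀ c : Fin l → R, ∑ i, c i • w i = 0 → ∀ i, c i ∈ maximalIdeal R := by
  classical
  have hex : ∃ l : ℕ, ∃ w : Fin l → W, Submodule.span R (Set.range w) = ⊤ :=
    Module.Finite.exists_fin
  obtain ⟨w, hw⟩ := Nat.find_spec hex
  refine ⟨_, w, hw, ?_⟩
  have hlt := fun m => @Nat.find_min _ _ hex m
  generalize Nat.find hex = l at w hw hlt
  intro c hc i
  by_contra hi
  have hu : IsUnit (c i) := by simpa using hi
  obtain ⟨n, rfl⟩ : ∃ n, l = n + 1 := ⟨l - 1, by have := i.2; omega⟩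
  refine hlt n (by omega) ⟨fun j => w (i.succAbove j), ?_⟩
  rw [eq_top_iff, ← hw, Submodule.span_le]
  rintro _ ⟨k, rfl⟩
  by_cases hk : k = i
  · subst hk
    rw [Fin.sum_univ_succAbove _ k] at hc
    obtain ⟨u, hu⟩ := hu
    have : w k = (↑u⁻¹ : R) • -(∑ j, c (k.succAbove j) • w (k.succAbove j)) := by
      rw [← eq_neg_of_add_eq_zero_left hc, ← hu, smul_smul, Units.inv_mul, one_smul]
    rw [this]
    exact Submodule.smul_mem _ _ (neg_mem (sum_mem fun j _ => Submodule.smul_mem _ _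
      (Submodule.subset_span ⟨j, rfl⟩)))
  · obtain ⟨j, rfl⟩ := Fin.exists_succAbove_eq hk
    exact Submodule.subset_span ⟨j, rfl⟩

lemma aux_free {R : Type} [CommRing R] [IsLocalRing R] [IsNoetherianRing R] (g t : R)
    (hm : maximalIdeal R = Ideal.span {g, t}) {W : Type} [AddCommGroup W] [Module R W]
    [Module.Finite R W]
    (hsoc : ∀ x : W, g • x = 0 → t • x = 0 → x = 0) (hg : ∀ x : W, g • x = 0) :
    ∃ l : ℕ, Nonempty (W ≃ₗ[R] (Fin l → (R ⧸ Ideal.span {g}))) := by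
  obtain ⟨l, w, hw, hmin⟩ := aux_mingen (R := R) (W := W)
  refine ⟨l, ⟨?_⟩⟩
  let f := Fintype.linearCombination R w
  have hf : Function.Surjective f := by
    rw [← LinearMap.range_eq_top, Fintype.range_linearCombination, hw]
  let q : (Fin l → R) →ₗ[R] (Fin l → R ⧸ Ideal.span {g}) :=
    LinearMap.pi fun i => (Submodule.mkQ (Ideal.span {g})) ∘ₗ LinearMap.proj i
  have hq : Function.Surjective q := by
    intro y
    choose z hz using fun i => Submodule.mkQ_surjective (Ideal.span {g}) (y i)
    exact ⟨z, funext hz⟩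
  have hk : LinearMap.ker f = LinearMap.ker q := by
    have hqk : ∀ c, q c = 0 ↔ ∀ i, c i ∈ Ideal.span {g} := fun c => by
      rw [funext_iff]
      exact forall_congr' fun i => Submodule.Quotient.mk_eq_zero _
    ext c
    rw [LinearMap.mem_ker, LinearMap.mem_ker, hqk, Fintype.linearCombination_apply]
    refine ⟨fun hc => aux_rel g t hm hsoc w (fun i => hg _) hmin c hc, fun hc => ?_⟩
    refine Finset.sum_eq_zero fun i _ => ?_
    obtain ⟨a, ha⟩ := Ideal.mem_span_singleton'.1 (hc i)
    rw [← ha, mul_smul, hg, smul_zero]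
  exact (f.quotKerEquivOfSurjective hf).symm ≪≫ₗ Submodule.quotEquivOfEq _ _ hk ≪≫ₗ
    q.quotKerEquivOfSurjective hq

lemma aux_N {R : Type} [CommRing R] [IsLocalRing R] [IsNoetherianRing R] (h g t : R)
    (hm : maximalIdeal R = Ideal.span {g, t}) (hgh : g * h = 0)
    {M : Type} [AddCommGroup M] [Module R M]
    (hsoc : ∀ x : M, g • x = 0 → t • x = 0 → x = 0)
    (hex : ∀ x : M, g • x = 0 → ∃ m, x = h • m) {l : ℕ} (a : Fin l → M)
    (hspan : ∀ m : M, h • m ∈ Submodule.span R (Set.range fun i => h • a i))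
    (hmin : ∀ c : Fin l → R, ∑ i, c i • (h • a i) = 0 → ∀ i, c i ∈ maximalIdeal R) :
    Module.Free R (Submodule.span R (Set.range a)) := by
  have hgm : g ∈ maximalIdeal R := by rw [hm]; exact Ideal.subset_span (by simp)
  suffices hli : LinearIndependent R a from Module.Free.of_basis (Module.Basis.span hli)
  rw [Fintype.linearIndependent_iff]
  have key : LinearMap.ker (Fintype.linearCombination R a) ≤ ⊥ := by
    refine Submodule.le_of_le_smul_of_le_jacobson_bot (I := maximalIdeal R)
      (IsNoetherian.noetherian _) (maximalIdeal_le_jacobson _) ?_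
    intro c hc
    have hc' : ∑ i, c i • a i = 0 := by simpa [Fintype.linearCombination_apply] using hc
    have h1 := aux_rel g t hm hsoc (fun i => h • a i)
      (fun i => by rw [smul_smul, hgh, zero_smul]) hmin c (by
        simp_rw [smul_comm _ h]
        rw [← Finset.smul_sum, hc', smul_zero])
    simp only [Ideal.mem_span_singleton'] at h1
    choose d hd using h1
    obtain ⟨m, hmm⟩ := hex (∑ i, d i • a i) (by
      rw [← hc', Finset.smul_sum]
      refine Finset.sum_congr rfl fun i _ => ?_
      rw [← hd i, mul_comm, mul_smul])
    obtain ⟨e, he⟩ := (Submodule.mem_span_range_iff_exists_fun R).1 (hspan m)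
    have hcd : c = g • (d - h • e) := by
      ext i
      simp only [Pi.smul_apply, Pi.sub_apply, smul_eq_mul, ← hd i]
      linear_combination e i * hgh
    rw [hcd]
    refine Submodule.mem_sup_right (Submodule.smul_mem_smul hgm ?_)
    rw [LinearMap.mem_ker, Fintype.linearCombination_apply]
    simp only [Pi.smul_apply, Pi.sub_apply, smul_eq_mul, sub_smul, Finset.sum_sub_distrib]
    rw [hmm, ← he, sub_eq_zero]
    exact Finset.sum_congr rfl fun i _ => by rw [smul_smul, mul_comm]
  intro c hc
  have := key (x := c) (by rw [LinearMap.mem_ker, Fintype.linearCombination_apply, hc])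
  rw [Submodule.mem_bot] at this
  simp [this]

lemma aux_soc {R : Type} [CommRing R] [IsLocalRing R] (M : Type) [AddCommGroup M] [Module R M]
    (hM : moduleDepth R M = 1) (x : M) (hx : ∀ r ∈ maximalIdeal R, r • x = 0) : x = 0 := by
  have he : Subsingleton (ExtGroup R 0 (ResidueField R) M) := by
    by_contra hne
    rw [not_subsingleton_iff_nontrivial] at hne
    have h0 : moduleDepth R M ≤ 0 := sInf_le ⟨0, by simp, hne⟩
    rw [hM] at h0
    exact absurd h0 (by simp)
  let f : (R ⧸ maximalIdeal R) →ₗ[R] M :=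
    Submodule.liftQ (maximalIdeal R) (LinearMap.toSpanSingleton R M x) (fun r hr => hx r hr)
  have hf : f = 0 := aux_ext0 (ResidueField R) M he f
  have h1 : f (Submodule.mkQ (maximalIdeal R) 1) = (1 : R) • x := rfl
  rw [hf, one_smul] at h1
  exact h1.symm

/-- Let `S` be a `2`-dimensional complete regular local ring, `g` a prime not in `m²`,
`R = S/(hg)` (with `hg` reduced), and `M` a maximal Cohen-Macaulay `R`-module with
`Ext_R^1(R/(h), M) = 0`.  Then `hM` is a free `R/(g)`-module, and for any minimal
generating set `ha_1, …, ha_l` of `hM`, the submodule `N = (a_1, …, a_l)` of `M` is a free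
`R`-module. -/
theorem hM_free_and_N_free
    (S : Type) [CommRing S] [IsLocalRing S] (hS : IsRegularLocalTwoDim S)
    (hcomp : IsAdicComplete (IsLocalRing.maximalIdeal S) S)
    (h g : S) (hh0 : h ≠ 0) (hgprime : Prime g)
    (hgm2 : g ∉ (IsLocalRing.maximalIdeal S) ^ 2)
    (hred : IsReduced (S ⧸ Ideal.span {h * g}))
    [IsLocalRing (S ⧸ Ideal.span {h * g})]
    (M : Type) [AddCommGroup M] [Module (S ⧸ Ideal.span {h * g}) M]
    (hM : IsMCM1 (S ⧸ Ideal.span {h * g}) M)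
    (hext : Subsingleton (ExtGroup (S ⧸ Ideal.span {h * g}) 1
      ((S ⧸ Ideal.span {h * g}) ⧸
        Ideal.span {Ideal.Quotient.mk (Ideal.span {h * g}) h}) M)) :
    (∃ l' : ℕ, Nonempty
      ((↥(Ideal.span {Ideal.Quotient.mk (Ideal.span {h * g}) h} •
          (⊤ : Submodule (S ⧸ Ideal.span {h * g}) M)))
        ≃ₗ[S ⧸ Ideal.span {h * g}]
        (Fin l' → ((S ⧸ Ideal.span {h * g}) ⧸
          Ideal.span {Ideal.Quotient.mk (Ideal.span {h * g}) g})))) ∧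
    (∀ (l : ℕ) (a : Fin l → M),
      Submodule.span (S ⧸ Ideal.span {h * g})
          (Set.range fun i => (Ideal.Quotient.mk (Ideal.span {h * g}) h) • a i) =
        (Ideal.span {Ideal.Quotient.mk (Ideal.span {h * g}) h} •
          (⊤ : Submodule (S ⧸ Ideal.span {h * g}) M)) →
      (∀ c : Fin l → (S ⧸ Ideal.span {h * g}),
        (∑ i, c i • ((Ideal.Quotient.mk (Ideal.span {h * g}) h) • a i)) = 0 →
        ∀ i, c i ∈ IsLocalRing.maximalIdeal (S ⧸ Ideal.span {h * g})) →
      Module.Free (S ⧸ Ideal.span {h * g})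
        (Submodule.span (S ⧸ Ideal.span {h * g}) (Set.range a))) := by
  obtain ⟨hN, hdim, x, y, hxy⟩ := hS
  obtain ⟨t, hm⟩ := aux_param x y g hxy hgprime.not_isUnit hgm2
  have hdom : IsDomain S := aux_domain g t hm hdim
  generalize hπ : Ideal.Quotient.mk (Ideal.span {h * g}) = π at *
  have hsurj : Function.Surjective π := by rw [← hπ]; exact Ideal.Quotient.mk_surjective
  have hker : ∀ s, π s = 0 ↔ h * g ∣ s := fun s => by
    rw [← hπ, Ideal.Quotient.eq_zero_iff_mem, Ideal.mem_span_singleton]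
  have hcm : (maximalIdeal (S ⧸ Ideal.span {h * g})).comap π = maximalIdeal S :=
    IsLocalRing.eq_maximalIdeal (Ideal.comap_isMaximal_of_surjective π hsurj)
  have hmR : maximalIdeal (S ⧸ Ideal.span {h * g}) = Ideal.span {π g, π t} := by
    rw [← Ideal.map_comap_of_surjective π hsurj (maximalIdeal (S ⧸ Ideal.span {h * g})), hcm, hm,
      Ideal.map_span, Set.image_pair]
  have hgh : π g * π h = 0 := by rw [← map_mul, hker, mul_comm]
  have hann : ∀ r, π h * r = 0 → ∃ s, r = s * π g := by
    intro r hr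
    obtain ⟨r, rfl⟩ := hsurj r
    rw [← map_mul, hker] at hr
    obtain ⟨s, hs⟩ := (mul_dvd_mul_iff_left hh0).1 hr
    exact ⟨π s, by rw [hs, map_mul]; exact mul_comm _ _⟩
  obtain ⟨hfin, hdep⟩ := hM
  have hsoc : ∀ x : M, π g • x = 0 → π t • x = 0 → x = 0 := by
    intro x h1 h2
    refine aux_soc M hdep x fun r hr => ?_
    rw [hmR, Ideal.mem_span_pair] at hr
    obtain ⟨a, b, rfl⟩ := hr
    rw [add_smul, mul_smul, mul_smul, h1, h2, smul_zero, smul_zero, add_zero]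
  have hex : ∀ x : M, π g • x = 0 → ∃ m, x = π h • m := aux_ext1 (π h) (π g) hann M hext
  refine ⟨?_, fun l a hspan hmin => ?_⟩
  · refine aux_free (π g) (π t) hmR (fun x h1 h2 => ?_) (fun x => ?_)
    · exact Subtype.ext (hsoc x (congrArg Subtype.val h1) (congrArg Subtype.val h2))
    · obtain ⟨x, hx⟩ := x
      rw [Submodule.ideal_span_singleton_smul] at hx
      obtain ⟨m, -, rfl⟩ := hx
      refine Subtype.ext ?_
      change π g • π h • m = 0
      rw [smul_smul, hgh, zero_smul]
  · refine aux_N (π h) (π g) (π t) hmR hgh hsoc hex a (fun m => ?_) hmin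
    rw [hspan]
    exact Submodule.smul_mem_smul (Ideal.mem_span_singleton_self _) trivial
end
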